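/- arXiv:1702.01377 — 2 statements merged into one kernel-verified Lean document; each statement's English description precedes it below -/
import Mathlib

section
/- (Difference equation.) Let k=(k_1,…,k_r) be a nonempty index and k_−=(k_1,…,k_{r−1}) (the empty index if r=1). Then for all z∈ℂ with Re(z)>0, F_k(z) − F_k(z−1) = F_{k_−}(z)/z^{k_r}, where F_∅(z)=1. -/
open MeasureTheory Filter Topology

namespace Kawashima

/-- The set `A(k) = {k₁, k₁+k₂, …, k₁+⋯+k_{r-1}}` of proper nonempty partial sums
of an index `k = (k₁, …, k_r)`. -/
def Aset (k : List ℕ) : Finset ℕ :=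
  (Finset.Ico 1 k.length).image (fun i => (k.take i).sum)

/-- The Hoffman dual of an index `k`: the unique index `k∨` with the same weight such
that `A(k)` and `A(k∨)` partition `{1, …, wt(k) - 1}`.  It is computed here as the
composition of `wt(k)` whose partial-sum set is the complement of `A(k)`. -/
def hdual (k : List ℕ) : List ℕ :=
  let w := k.sum
  let L := (insert w ((Finset.Icc 1 (w - 1)) \ Aset k)).sort (· ≤ ·)
  L.zipWith (fun a b => a - b) (0 :: L)

/-- `sStar k N = s⋆(k, N) = Σ_{0 < m₁ ≤ ⋯ ≤ m_{r-1} ≤ m_r = N} 1/(m₁^{k₁} ⋯ m_r^{k_r})`.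
For the empty index the value is `1` (empty product), and for a nonempty index and
`N = 0` the value is `0` (empty sum). -/
noncomputable def sStar (k : List ℕ) (N : ℕ) : ℝ :=
  ∑ m : Fin k.length → Fin (N + 1),
    if (∀ i, 0 < (m i : ℕ)) ∧
       (∀ i j : Fin k.length, i ≤ j → (m i : ℕ) ≤ (m j : ℕ)) ∧
       (∀ i : Fin k.length, (i : ℕ) + 1 = k.length → (m i : ℕ) = N)
    then ∏ i : Fin k.length, 1 / ((m i : ℕ) : ℝ) ^ k.get i
    else 0

/-- `SStar k N = S⋆(k, N) = Σ_{n=1}^N s⋆(k, n)`. -/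
noncomputable def SStar (k : List ℕ) (N : ℕ) : ℝ :=
  ∑ n ∈ Finset.Icc 1 N, sStar k n

/-- The binomial coefficient `binom(z, n) = z(z-1)⋯(z-n+1)/n!` for complex `z`. -/
noncomputable def cbinom (z : ℂ) (n : ℕ) : ℂ :=
  (descPochhammer ℂ n).eval z / (n.factorial : ℂ)

/-- The Kawashima function
`F_k(z) = Σ_{n=1}^∞ (-1)^{n-1} s⋆(k∨, n) binom(z, n)`, with `F_∅(z) = 1`. -/
noncomputable def F (k : List ℕ) (z : ℂ) : ℂ :=
  if k = [] then 1
  else ∑' n : ℕ, (-1 : ℂ) ^ n * ((sStar (hdual k) (n + 1) : ℝ) : ℂ) * cbinom z (n + 1)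

/-- The domain `Δ(k) ⊆ (0,1)^{wt(k)}`: `t_j < t_{j+1}` if `j ∈ A(k)` and
`t_j > t_{j+1}` otherwise (positions `1`-indexed). -/
def Delta (k : List ℕ) : Set (Fin k.sum → ℝ) :=
  {t | (∀ j, t j ∈ Set.Ioo (0 : ℝ) 1) ∧
       ∀ (i : Fin k.sum) (h : (i : ℕ) + 1 < k.sum),
         if (i : ℕ) + 1 ∈ Aset k then t i < t ⟨(i : ℕ) + 1, h⟩
         else t ⟨(i : ℕ) + 1, h⟩ < t i}

/-- The multiple zeta value `ζ(k) = Σ_{0 < m₁ < ⋯ < m_r} 1/(m₁^{k₁} ⋯ m_r^{k_r})`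
(as a `tsum`; it converges for admissible `k`), with `ζ(∅) = 1`. -/
noncomputable def mzv (k : List ℕ) : ℝ :=
  ∑' m : Fin k.length → ℕ,
    if (∀ i, 0 < m i) ∧ (∀ i j : Fin k.length, i < j → m i < m j)
    then ∏ i : Fin k.length, 1 / ((m i : ℕ) : ℝ) ^ k.get i
    else 0

/-- `ζ` extended `ℚ`-linearly to formal `ℚ`-linear combinations of indices. -/
noncomputable def zetaL (v : List ℕ →₀ ℚ) : ℝ :=
  v.sum fun k a => (a : ℝ) * mzv k

/-- The Kawashima function extended `ℚ`-linearly to formal combinations of indices. -/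
noncomputable def FL (v : List ℕ →₀ ℚ) (z : ℂ) : ℂ :=
  v.sum fun k a => (a : ℂ) * F k z

/-- Auxiliary harmonic product, on *reversed* indices (so that the rightmost entry of
the index is the head of the list):
`k * l = (k₋ * l, k_r) + (k * l₋, l_s) + (k₋ * l₋, k_r + l_s)`. -/
noncomputable def hstarAux : List ℕ → List ℕ → (List ℕ →₀ ℚ)
  | [], l => Finsupp.single l 1
  | a :: k, [] => Finsupp.single (a :: k) 1
  | a :: k, b :: l =>
      Finsupp.mapDomain (List.cons a) (hstarAux k (b :: l)) +
      Finsupp.mapDomain (List.cons b) (hstarAux (a :: k) l) +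
      Finsupp.mapDomain (List.cons (a + b)) (hstarAux k l)
  termination_by k l => k.length + l.length

/-- The harmonic product `k * l` of two indices, as a `ℚ`-linear combination of
indices. -/
noncomputable def hstar (k l : List ℕ) : List ℕ →₀ ℚ :=
  Finsupp.mapDomain List.reverse (hstarAux k.reverse l.reverse)

/-- Auxiliary product `*̄` on reversed indices:
`k *̄ l = (k₋ *̄ l, k_r) + (k *̄ l₋, l_s) - (k₋ *̄ l₋, k_r + l_s)`. -/
noncomputable def hbarAux : List ℕ → List ℕ → (List ℕ →₀ ℚ)
  | [], l => Finsupp.single l 1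
  | a :: k, [] => Finsupp.single (a :: k) 1
  | a :: k, b :: l =>
      Finsupp.mapDomain (List.cons a) (hbarAux k (b :: l)) +
      Finsupp.mapDomain (List.cons b) (hbarAux (a :: k) l) -
      Finsupp.mapDomain (List.cons (a + b)) (hbarAux k l)
  termination_by k l => k.length + l.length

/-- The harmonic product `k *̄ l` of two indices. -/
noncomputable def hbar (k l : List ℕ) : List ℕ →₀ ℚ :=
  Finsupp.mapDomain List.reverse (hbarAux k.reverse l.reverse)

/-- The product `k ⊛ l = (k₋ * l₋, k_r + l_s)` for nonempty indices `k`, `l`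
(and `0` if either is empty). -/
noncomputable def circAst (k l : List ℕ) : List ℕ →₀ ℚ :=
  match k.reverse, l.reverse with
  | a :: k', b :: l' =>
      Finsupp.mapDomain List.reverse
        (Finsupp.mapDomain (List.cons (a + b)) (hstarAux k' l'))
  | _, _ => 0

/-- `⊛` extended bilinearly to formal combinations. -/
noncomputable def circAstL (v w : List ℕ →₀ ℚ) : List ℕ →₀ ℚ :=
  v.sum fun k a => w.sum fun l b => (a * b) • circAst k l

/-- The star operator `k ↦ k⋆`: the sum over all ways to replace commas by pluses
in groups of consecutive entries,
`(k₁,…,k_r)⋆ = Σ_{0<j₁<⋯<j_q=r} (k₁+⋯+k_{j₁}, …, k_{j_{q-1}+1}+⋯+k_{j_q})`. -/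
noncomputable def starOp : List ℕ → (List ℕ →₀ ℚ)
  | [] => Finsupp.single [] 1
  | [a] => Finsupp.single [a] 1
  | a :: b :: k =>
      Finsupp.mapDomain (List.cons a) (starOp (b :: k)) + starOp ((a + b) :: k)
  termination_by k => k.length

/-- The star operator extended `ℚ`-linearly. -/
noncomputable def starL (v : List ℕ →₀ ℚ) : List ℕ →₀ ℚ :=
  v.sum fun k a => a • starOp k

open Classical in
/-- Kawashima's function `G_k(z)`: the sum over tuples `0 < n₁, …, n_w` with
`n_j < n_{j+1}` if `j ∉ A(k)` and `n_j ≤ n_{j+1}` if `j ∈ A(k)`, of the product of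
the factors `1/(n_j + z)` at positions `j ∈ A(k)`, the factor
`1/n_w - 1/(n_w + z)` at the last position, and `1/n_j` elsewhere. -/
noncomputable def G (k : List ℕ) (z : ℂ) : ℂ :=
  ∑' n : Fin k.sum → ℕ,
    if (∀ j, 0 < n j) ∧
       (∀ (i : Fin k.sum) (h : (i : ℕ) + 1 < k.sum),
          if (i : ℕ) + 1 ∈ Aset k then n i ≤ n ⟨(i : ℕ) + 1, h⟩
          else n i < n ⟨(i : ℕ) + 1, h⟩)
    then ∏ j : Fin k.sum,
      if (j : ℕ) + 1 = k.sum then 1 / ((n j : ℕ) : ℂ) - 1 / (((n j : ℕ) : ℂ) + z)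
      else if (j : ℕ) + 1 ∈ Aset k then 1 / (((n j : ℕ) : ℂ) + z)
      else 1 / ((n j : ℕ) : ℂ)
    else 0

open Classical in
/-- `ζ_k(l) = Σ 1/(n₁^{l₁} ⋯ n_w^{l_w})`, summed over the same set of tuples as in
the definition of `G_k`. -/
noncomputable def zetaIdx (k : List ℕ) (l : List ℕ) : ℝ :=
  ∑' n : Fin k.sum → ℕ,
    if (∀ j, 0 < n j) ∧
       (∀ (i : Fin k.sum) (h : (i : ℕ) + 1 < k.sum),
          if (i : ℕ) + 1 ∈ Aset k then n i ≤ n ⟨(i : ℕ) + 1, h⟩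
          else n i < n ⟨(i : ℕ) + 1, h⟩)
    then ∏ j : Fin k.sum, 1 / ((n j : ℕ) : ℝ) ^ (l.getD (j : ℕ) 0)
    else 0

/-- `C_m(k) = Σ_{l₁,…,l_{r-1} ≥ 0, l_r ≥ 1, l₁+⋯+l_r = m}
ζ_k(1,…,1 (k₁-1 ones), l₁+1, …, 1,…,1 (k_r-1 ones), l_r+1)`. -/
noncomputable def Cm (k : List ℕ) (m : ℕ) : ℝ :=
  ∑ l : Fin k.length → Fin (m + 1),
    if (∑ i, (l i : ℕ)) = m ∧
       (∀ i : Fin k.length, (i : ℕ) + 1 = k.length → 1 ≤ (l i : ℕ))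
    then zetaIdx k
      ((List.ofFn (fun i : Fin k.length =>
          List.replicate (k.get i - 1) 1 ++ [(l i : ℕ) + 1])).flatten)
    else 0

/-- The iterated integral `A_m(k)` over `Δ((k,1,…,1))` (`m` trailing ones) of
`ω_{δ(1)}(t₁) ⋯ ω_{δ(w-1)}(t_{w-1}) · dt_w/(1-t_w) · dt_{w+1}/t_{w+1} ⋯ dt_{w+m}/t_{w+m}`. -/
noncomputable def Aint (k : List ℕ) (m : ℕ) : ℝ :=
  ∫ t in Delta (k ++ List.replicate m 1),
    ∏ i : Fin (k ++ List.replicate m 1).sum,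
      if (i : ℕ) + 1 < k.sum then
        (if (i : ℕ) + 1 ∈ Aset k then 1 / (1 - t i) else 1 / t i)
      else if (i : ℕ) + 1 = k.sum then 1 / (1 - t i)
      else 1 / t i

/-- The digamma function `ψ(z) = Γ'(z)/Γ(z)`. -/
noncomputable def digamma (z : ℂ) : ℂ := deriv Complex.Gamma z / Complex.Gamma z




/-- The successive differences `L₁ - 0, L₂ - L₁, …` of a list. -/
def successiveDiffs (L : List ℕ) : List ℕ :=
  L.zipWith (fun a b => a - b) (0 :: L)

theorem successiveDiffs_append_singleton (L : List ℕ) (x : ℕ) :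
    successiveDiffs (L ++ [x]) = successiveDiffs L ++ [x - L.getLastD 0] := by
  rcases L.eq_nil_or_concat with rfl | ⟨M, y, rfl⟩
  · simp [successiveDiffs]
  · have h1 : successiveDiffs (M ++ [y] ++ [x]) =
        List.zipWith (fun a b => a - b) ((M ++ [y]) ++ [x]) ((0 :: M) ++ [y]) := by
      have h := List.zipWith_append (f := fun a b : ℕ => a - b) (l₁ := M ++ [y] ++ [x])
        (l₁' := []) (l₂ := (0 :: M) ++ [y]) (l₂' := [x])  (by simp)
      simpa [successiveDiffs] using h
    have h2 : successiveDiffs (M ++ [y]) =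
        List.zipWith (fun a b => a - b) (M ++ [y]) (0 :: M) := by
      have h := List.zipWith_append (f := fun a b : ℕ => a - b) (l₁ := M ++ [y])
        (l₁' := []) (l₂ := (0 :: M)) (l₂' := [y])  (by simp)
      simpa [successiveDiffs] using h
    rw [List.concat_eq_append, h1, h2, List.zipWith_append (by simp)]
    simp

/-- The complement of `A(k)` in `{1, …, wt(k) - 1}`. -/
def complAset (k : List ℕ) : Finset ℕ :=
  Finset.Icc 1 (k.sum - 1) \ Aset k

theorem sort_insert_of_lt (s : Finset ℕ) (w : ℕ) (h : ∀ x ∈ s, x < w) :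
    (insert w s).sort (· ≤ ·) = s.sort (· ≤ ·) ++ [w] := by
  have hn : (s.sort (· ≤ ·) ++ [w]).Nodup := by
    rw [List.nodup_append]
    refine ⟨Finset.sort_nodup _ _, by simp, ?_⟩
    intro a ha b hb
    have := h a ((Finset.mem_sort _).1 ha)
    simp only [List.mem_singleton] at hb
    omega
  have hs : (s.sort (· ≤ ·) ++ [w]).toFinset = insert w s := by
    ext x; simp
  rw [← hs, List.toFinset_sort _ hn, List.pairwise_append]
  refine ⟨Finset.pairwise_sort _ _, by simp, ?_⟩
  intro a ha b hb
  have := h a ((Finset.mem_sort _).1 ha)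
  simp only [List.mem_singleton] at hb
  omega

theorem lt_sum_of_mem_complAset {k : List ℕ} {x : ℕ} (hx : x ∈ complAset k) : x < k.sum := by
  simp only [complAset, Finset.mem_sdiff, Finset.mem_Icc] at hx
  omega

theorem hdual_eq (k : List ℕ) :
    hdual k = successiveDiffs ((complAset k).sort (· ≤ ·)) ++
      [k.sum - ((complAset k).sort (· ≤ ·)).getLastD 0] := by
  rw [← successiveDiffs_append_singleton,
    ← sort_insert_of_lt _ _ fun _ => lt_sum_of_mem_complAset]
  rfl

theorem getLastD_complAset_le (k : List ℕ) :
    ((complAset k).sort (· ≤ ·)).getLastD 0 ≤ k.sum := by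
  rcases ((complAset k).sort (· ≤ ·)).eq_nil_or_concat with h | ⟨M, y, h⟩
  · simp [h]
  · have : y ∈ complAset k := by
      rw [← Finset.mem_sort (r := (· ≤ ·)), h]; simp
    rw [h]
    simpa using (lt_sum_of_mem_complAset this).le

theorem Aset_append_singleton (l : List ℕ) (hl : l ≠ []) (a : ℕ) :
    Aset (l ++ [a]) = insert l.sum (Aset l) := by
  have hlen : 1 ≤ l.length := List.length_pos_iff.2 hl
  have h1 : Finset.Ico 1 (l ++ [a]).length = insert l.length (Finset.Ico 1 l.length) := by
    ext x; simp; omega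
  rw [Aset, h1, Finset.image_insert]
  congr 1
  · simp
  · refine Finset.image_congr fun i hi => ?_
    simp only [Finset.coe_Ico, Set.mem_Ico] at hi
    simp [List.take_append_of_le_length hi.2.le]

theorem Aset_append_singleton_congr (l : List ℕ) (a b : ℕ) :
    Aset (l ++ [a]) = Aset (l ++ [b]) := by
  rcases eq_or_ne l [] with rfl | hl
  · simp [Aset]
  · rw [Aset_append_singleton l hl, Aset_append_singleton l hl]

theorem lt_sum_of_mem_Aset {k : List ℕ} (hpos : ∀ x ∈ k, 0 < x) {x : ℕ} (hx : x ∈ Aset k) :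
    x < k.sum := by
  simp only [Aset, Finset.mem_image, Finset.mem_Ico] at hx
  obtain ⟨i, ⟨_, hi⟩, rfl⟩ := hx
  have h1 : (k.take i).sum + (k.drop i).sum = k.sum := by
    rw [← List.sum_append, List.take_append_drop]
  have h2 : 0 < (k.drop i).sum := by
    rw [List.drop_eq_getElem_cons hi, List.sum_cons]
    have := hpos _ (List.getElem_mem hi)
    omega
  omega

theorem hdual_append_succ (l : List ℕ) (a : ℕ) (hl : ∀ x ∈ l, 0 < x) (ha : 0 < a) :
    hdual (l ++ [a + 1]) = hdual (l ++ [a]) ++ [1] := by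
  have hA := Aset_append_singleton_congr l (a + 1) a
  have hpos : ∀ x ∈ l ++ [a], 0 < x := by
    simp only [List.mem_append, List.mem_singleton]
    rintro x (hx | rfl)
    exacts [hl x hx, ha]
  have hw : (l ++ [a + 1]).sum = (l ++ [a]).sum + 1 := by simp; omega
  have hw' : 0 < (l ++ [a]).sum := by simp; omega
  have hC : complAset (l ++ [a + 1]) = insert (l ++ [a]).sum (complAset (l ++ [a])) := by
    ext x
    have hx := fun h : x ∈ Aset (l ++ [a]) => lt_sum_of_mem_Aset hpos h
    simp only [complAset, hA, hw, Finset.mem_sdiff, Finset.mem_Icc, Finset.mem_insert]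
    grind
  rw [hdual_eq, hC, sort_insert_of_lt _ _ fun _ => lt_sum_of_mem_complAset,
    successiveDiffs_append_singleton, ← hdual_eq, hw]
  simp

theorem hdual_append_one (l : List ℕ) (hne : l ≠ []) :
    ∃ q b, hdual l = q ++ [b] ∧ hdual (l ++ [1]) = q ++ [b + 1] := by
  have hw : (l ++ [1]).sum = l.sum + 1 := by simp
  have hC : complAset (l ++ [1]) = complAset l := by
    ext x
    simp only [complAset, Aset_append_singleton l hne, hw, Finset.mem_sdiff, Finset.mem_Icc,
      Finset.mem_insert]
    grind
  refine ⟨_, _, hdual_eq l, ?_⟩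
  have := getLastD_complAset_le l
  rw [hdual_eq, hC, hw, Nat.sub_add_comm this]

theorem hdual_singleton_one : hdual [1] = [1] := by
  simp [hdual_eq, complAset, successiveDiffs]

/-- The truncated sum `S⋆`, with the index read from right to left:
`truncSum (k_r, …, k₁) N = Σ_{0 < m₁ ≤ ⋯ ≤ m_r ≤ N} 1/(m₁^{k₁} ⋯ m_r^{k_r})`. -/
noncomputable def truncSum : List ℕ → ℕ → ℝ
  | [], _ => 1
  | a :: l, N => ∑ M ∈ Finset.Icc 1 N, truncSum l M / (M : ℝ) ^ a

theorem sum_monotone_le_eq_truncSum (B : ℕ) (r : ℕ) (f : Fin r → ℕ) (N : ℕ) (hN : N ≤ B) :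
    (∑ m : Fin r → Fin (B + 1),
      if (∀ i, 0 < (m i : ℕ)) ∧ (∀ i j : Fin r, i ≤ j → (m i : ℕ) ≤ (m j : ℕ)) ∧
        (∀ i, (m i : ℕ) ≤ N)
      then ∏ i : Fin r, 1 / ((m i : ℕ) : ℝ) ^ f i else 0) =
      truncSum (List.ofFn f).reverse N := by
  induction r generalizing N with
  | zero => simp [truncSum]
  | succ r ih =>
    have hcond : ∀ (M : Fin (B + 1)) (m : Fin r → Fin (B + 1)),
        ((∀ i, 0 < ((Fin.snoc m M : Fin (r + 1) → Fin (B + 1)) i : ℕ)) ∧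
          (∀ i j : Fin (r + 1), i ≤ j → ((Fin.snoc m M : Fin (r + 1) → Fin (B + 1)) i : ℕ) ≤
            ((Fin.snoc m M : Fin (r + 1) → Fin (B + 1)) j : ℕ)) ∧
          (∀ i, ((Fin.snoc m M : Fin (r + 1) → Fin (B + 1)) i : ℕ) ≤ N)) ↔
        (M : ℕ) ∈ Finset.Icc 1 N ∧
          ((∀ i, 0 < (m i : ℕ)) ∧ (∀ i j : Fin r, i ≤ j → (m i : ℕ) ≤ (m j : ℕ)) ∧
            (∀ i, (m i : ℕ) ≤ M)) := by
      intro M m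
      simp only [Fin.forall_fin_succ', Fin.snoc_castSucc, Fin.snoc_last, Finset.mem_Icc,
        Fin.castSucc_le_castSucc_iff, Fin.le_last, le_refl, forall_true_left, and_true]
      constructor
      · rintro ⟨⟨h1, h2⟩, ⟨h3, _⟩, h4, h5⟩
        exact ⟨⟨h2, h5⟩, h1, fun i j => (h3 i).1 j, fun i => (h3 i).2⟩
      · rintro ⟨⟨h2, h5⟩, h1, h3, h4⟩
        exact ⟨⟨h1, h2⟩, ⟨fun i => ⟨h3 i, h4 i⟩, fun i hi => absurd hi (by simp [Fin.le_def])⟩,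
          fun i => (h4 i).trans h5, h5⟩
    rw [← (Fin.snocEquiv fun _ : Fin (r + 1) => Fin (B + 1)).sum_comp, Fintype.sum_prod_type,
      List.ofFn_succ', List.concat_eq_append, List.reverse_append]
    simp only [Fin.snocEquiv_apply, List.reverse_singleton, List.singleton_append, truncSum]
    have hB : ∀ g : ℕ → ℝ, ∑ M ∈ Finset.Icc 1 N, g M =
        ∑ M : Fin (B + 1), if (M : ℕ) ∈ Finset.Icc 1 N then g M else 0 := by
      intro g
      rw [Fin.sum_univ_eq_sum_range (fun M => if M ∈ Finset.Icc 1 N then g M else 0),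
        ← Finset.sum_filter]
      refine Finset.sum_congr ?_ fun _ _ => rfl
      ext x; simp; omega
    rw [hB]
    refine Finset.sum_congr rfl fun M _ => ?_
    simp only [hcond]
    by_cases hM : (M : ℕ) ∈ Finset.Icc 1 N
    · simp only [hM, true_and, if_true, Fin.prod_univ_castSucc, Fin.snoc_castSucc, Fin.snoc_last]
      rw [← ih (fun i => f i.castSucc) M (by simp at hM; omega), Finset.sum_div]
      refine Finset.sum_congr rfl fun m _ => ?_
      split_ifs <;> simp [div_eq_mul_inv]
    · simp [hM]

theorem sum_monotone_last_eq (N : ℕ) (hN : 0 < N) (r : ℕ) (f : Fin (r + 1) → ℕ) :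
    (∑ m : Fin (r + 1) → Fin (N + 1),
      if (∀ i, 0 < (m i : ℕ)) ∧ (∀ i j : Fin (r + 1), i ≤ j → (m i : ℕ) ≤ (m j : ℕ)) ∧
        (∀ i : Fin (r + 1), (i : ℕ) + 1 = r + 1 → (m i : ℕ) = N)
      then ∏ i : Fin (r + 1), 1 / ((m i : ℕ) : ℝ) ^ f i else 0) =
      truncSum (List.ofFn fun i : Fin r => f i.castSucc).reverse N /
        (N : ℝ) ^ f (Fin.last r) := by
  have hcond : ∀ (M : Fin (N + 1)) (m : Fin r → Fin (N + 1)),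
      ((∀ i, 0 < ((Fin.snoc m M : Fin (r + 1) → Fin (N + 1)) i : ℕ)) ∧
        (∀ i j : Fin (r + 1), i ≤ j → ((Fin.snoc m M : Fin (r + 1) → Fin (N + 1)) i : ℕ) ≤
          ((Fin.snoc m M : Fin (r + 1) → Fin (N + 1)) j : ℕ)) ∧
        (∀ i : Fin (r + 1), (i : ℕ) + 1 = r + 1 →
          ((Fin.snoc m M : Fin (r + 1) → Fin (N + 1)) i : ℕ) = N)) ↔
      M = Fin.last N ∧
        ((∀ i, 0 < (m i : ℕ)) ∧ (∀ i j : Fin r, i ≤ j → (m i : ℕ) ≤ (m j : ℕ)) ∧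
          (∀ i, (m i : ℕ) ≤ N)) := by
    intro M m
    simp only [Fin.forall_fin_succ', Fin.snoc_castSucc, Fin.snoc_last,
      Fin.castSucc_le_castSucc_iff, Fin.le_last, le_refl, forall_true_left, and_true,
      Fin.val_castSucc, Fin.val_last, Fin.ext_iff]
    constructor
    · rintro ⟨⟨h1, h2⟩, ⟨h3, _⟩, h4, h5⟩
      exact ⟨h5, h1, fun i j => (h3 i).1 j, fun i => (h3 i).2.trans h5.le⟩
    · rintro ⟨h5, h1, h3, h4⟩
      refine ⟨⟨h1, by omega⟩, ⟨fun i => ⟨h3 i, (h4 i).trans h5.ge⟩,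
        fun i hi => absurd hi (by simp [Fin.le_def])⟩, fun i hi => ?_, h5⟩
      have := i.2
      omega
  rw [← (Fin.snocEquiv fun _ : Fin (r + 1) => Fin (N + 1)).sum_comp, Fintype.sum_prod_type]
  simp only [Fin.snocEquiv_apply, hcond]
  rw [Finset.sum_eq_single (Fin.last N) (fun M _ hM => by simp [hM]) (by simp)]
  rw [← sum_monotone_le_eq_truncSum N r _ N le_rfl, Finset.sum_div]
  refine Finset.sum_congr rfl fun m _ => ?_
  simp only [true_and, Fin.prod_univ_castSucc, Fin.snoc_castSucc, Fin.snoc_last, Fin.val_last]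
  split_ifs <;> simp [div_eq_mul_inv]

theorem sStar_eq_sum_of_length_eq (k : List ℕ) (N r : ℕ) (h : k.length = r) :
    sStar k N = ∑ m : Fin r → Fin (N + 1),
      if (∀ i, 0 < (m i : ℕ)) ∧ (∀ i j : Fin r, i ≤ j → (m i : ℕ) ≤ (m j : ℕ)) ∧
        (∀ i : Fin r, (i : ℕ) + 1 = r → (m i : ℕ) = N)
      then ∏ i : Fin r, 1 / ((m i : ℕ) : ℝ) ^ k.get (i.cast h.symm) else 0 := by
  subst h
  rfl

theorem sStar_append_singleton (q : List ℕ) (b N : ℕ) (hN : 0 < N) :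
    sStar (q ++ [b]) N = truncSum q.reverse N / (N : ℝ) ^ b := by
  rw [sStar_eq_sum_of_length_eq _ N (q.length + 1) (by simp), sum_monotone_last_eq N hN]
  congr 2
  · congr 1
    apply List.ext_getElem <;> simp
  · simp

theorem mul_sStar_hdual_append_succ (l : List ℕ) (a : ℕ) (hl : ∀ x ∈ l, 0 < x) (ha : 0 < a)
    (n : ℕ) (hn : 0 < n) :
    n * sStar (hdual (l ++ [a + 1])) n = ∑ m ∈ Finset.Icc 1 n, sStar (hdual (l ++ [a])) m := by
  have hn' : (n : ℝ) ≠ 0 := by positivity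
  rw [hdual_append_succ l a hl ha, sStar_append_singleton _ _ _ hn, hdual_eq (l ++ [a]),
    List.reverse_append, pow_one, mul_div_cancel₀ _ hn']
  simp only [List.reverse_singleton, List.singleton_append, truncSum]
  refine Finset.sum_congr rfl fun m hm => ?_
  rw [sStar_append_singleton _ _ _ (Finset.mem_Icc.1 hm).1]

theorem mul_sStar_hdual_append_one (l : List ℕ) (hne : l ≠ []) (n : ℕ) (hn : 0 < n) :
    n * sStar (hdual (l ++ [1])) n = sStar (hdual l) n := by
  have hn' : (n : ℝ) ≠ 0 := by positivity
  obtain ⟨q, b, h1, h2⟩ := hdual_append_one l hne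
  rw [h1, h2, sStar_append_singleton _ _ _ hn, sStar_append_singleton _ _ _ hn]
  field_simp
  ring

theorem mul_sStar_hdual_singleton_one (n : ℕ) (hn : 0 < n) : n * sStar (hdual [1]) n = 1 := by
  have hn' : (n : ℝ) ≠ 0 := by positivity
  rw [hdual_singleton_one, ← List.nil_append [1], sStar_append_singleton _ _ _ hn]
  simp [truncSum, hn']

theorem sStar_nonneg (k : List ℕ) (N : ℕ) : 0 ≤ sStar k N :=
  Finset.sum_nonneg fun m _ => by split_ifs <;> positivity

theorem exists_mul_sStar_hdual_le (k : List ℕ) (hk : k ≠ []) (hpos : ∀ x ∈ k, 0 < x) :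
    ∃ p : ℕ, ∀ n : ℕ, 0 < n → n * sStar (hdual k) n ≤ (1 + Real.log n) ^ p := by
  induction k using List.reverseRecOn with
  | nil => exact absurd rfl hk
  | append_singleton l a ih =>
    have hl : ∀ x ∈ l, 0 < x := fun x hx => hpos x (by simp [hx])
    have ha : 1 ≤ a := hpos a (by simp)
    clear hk hpos
    induction a, ha using Nat.le_induction with
    | base =>
      rcases eq_or_ne l [] with rfl | hne
      · exact ⟨0, fun n hn => by
          rw [List.nil_append, mul_sStar_hdual_singleton_one n hn, pow_zero]⟩
      · obtain ⟨p, hp⟩ := ih hne hl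
        refine ⟨p, fun n hn => le_trans ?_ (hp n hn)⟩
        rw [mul_sStar_hdual_append_one l hne n hn]
        exact le_mul_of_one_le_left (sStar_nonneg _ _) (by exact_mod_cast hn)
    | succ a ha iha =>
      obtain ⟨p, hp⟩ := iha
      refine ⟨p + 1, fun n hn => ?_⟩
      have hn1 : (1 : ℝ) ≤ n := by exact_mod_cast hn
      rw [mul_sStar_hdual_append_succ l a hl ha n hn]
      calc ∑ m ∈ Finset.Icc 1 n, sStar (hdual (l ++ [a])) m
          ≤ ∑ m ∈ Finset.Icc 1 n, (1 + Real.log n) ^ p * (m : ℝ)⁻¹ := by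
            refine Finset.sum_le_sum fun m hm => ?_
            rw [Finset.mem_Icc] at hm
            have hm1 : (1 : ℝ) ≤ m := by exact_mod_cast hm.1
            have hmn : (m : ℝ) ≤ n := by exact_mod_cast hm.2
            have h2 : (1 + Real.log m) ^ p ≤ (1 + Real.log n) ^ p := by
              have := Real.log_nonneg hm1
              have := Real.log_le_log (by linarith) hmn
              gcongr
            rw [← div_eq_mul_inv, le_div_iff₀' (by linarith)]
            exact (hp m hm.1).trans h2
        _ = (1 + Real.log n) ^ p * (harmonic n : ℝ) := by
            rw [← Finset.mul_sum, harmonic_eq_sum_Icc]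
            push_cast
            rfl
        _ ≤ _ := by
            rw [pow_succ]
            have := Real.log_nonneg hn1
            exact mul_le_mul_of_nonneg_left (harmonic_le_one_add_log n) (by positivity)

open Asymptotics

theorem isBigO_mul_sStar_hdual (k : List ℕ) (hk : k ≠ []) (hpos : ∀ x ∈ k, 0 < x)
    (ε : ℝ) (hε : 0 < ε) :
    (fun n : ℕ => n * sStar (hdual k) n) =O[atTop] fun n : ℕ => (n : ℝ) ^ ε := by
  obtain ⟨p, hp⟩ := exists_mul_sStar_hdual_le k hk hpos
  have h1 : (fun n : ℕ => n * sStar (hdual k) n) =O[atTop]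
      fun n : ℕ => (1 + Real.log n) ^ p := by
    refine IsBigO.of_bound 1 ?_
    filter_upwards [eventually_gt_atTop 0] with n hn
    have := sStar_nonneg (hdual k) n
    rw [Real.norm_of_nonneg (by positivity), one_mul]
    exact (hp n hn).trans (Real.le_norm_self _)
  have hδ : 0 < ε / (p + 1) := by positivity
  have h2 : (fun x : ℝ => 1 + Real.log x) =O[atTop] fun x : ℝ => x ^ (ε / (p + 1)) := by
    refine IsBigO.add ?_ (isLittleO_log_rpow_atTop hδ).isBigO
    exact ((isLittleO_const_left.2 (Or.inr
      (tendsto_norm_atTop_atTop.comp (tendsto_rpow_atTop hδ))))).isBigO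
  have h3 := (h2.pow p).comp_tendsto tendsto_natCast_atTop_atTop
  refine h1.trans (h3.trans (IsBigO.of_bound 1 ?_))
  filter_upwards [eventually_ge_atTop 1] with n hn
  have hn1 : (1 : ℝ) ≤ n := by exact_mod_cast hn
  simp only [Function.comp]
  rw [Real.norm_of_nonneg (by positivity), Real.norm_of_nonneg (by positivity), one_mul,
    ← Real.rpow_natCast, ← Real.rpow_mul (by positivity)]
  refine Real.rpow_le_rpow_of_exponent_le hn1 ?_
  rw [div_mul_eq_mul_div, div_le_iff₀ (by positivity)]
  nlinarith

theorem cbinom_zero_right (z : ℂ) : cbinom z 0 = 1 := by simp [cbinom]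

theorem succ_mul_cbinom_succ (z : ℂ) (n : ℕ) :
    ((n : ℂ) + 1) * cbinom z (n + 1) = cbinom z n * (z - n) := by
  have h1 : ((n : ℂ) + 1) ≠ 0 := by exact_mod_cast n.succ_ne_zero
  have h2 : ((n.factorial : ℕ) : ℂ) ≠ 0 := by exact_mod_cast n.factorial_ne_zero
  rw [cbinom, cbinom, descPochhammer_succ_eval, Nat.factorial_succ]
  push_cast
  field_simp

theorem succ_mul_cbinom_succ' (z : ℂ) (n : ℕ) :
    ((n : ℂ) + 1) * cbinom z (n + 1) = z * cbinom (z - 1) n := by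
  have h1 : ((n : ℂ) + 1) ≠ 0 := by exact_mod_cast n.succ_ne_zero
  have h2 : ((n.factorial : ℕ) : ℂ) ≠ 0 := by exact_mod_cast n.factorial_ne_zero
  rw [cbinom, cbinom, descPochhammer_succ_left, Nat.factorial_succ]
  simp only [Polynomial.eval_mul, Polynomial.eval_X, Polynomial.eval_comp, Polynomial.eval_sub,
    Polynomial.eval_one]
  push_cast
  field_simp

theorem cbinom_succ_sub (z : ℂ) (n : ℕ) :
    cbinom z (n + 1) - cbinom (z - 1) (n + 1) = cbinom (z - 1) n := by
  have h1 : ((n : ℂ) + 1) ≠ 0 := by exact_mod_cast n.succ_ne_zero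
  apply mul_left_cancel₀ h1
  rw [mul_sub, succ_mul_cbinom_succ', succ_mul_cbinom_succ]
  ring

theorem sum_neg_one_pow_mul_cbinom (z : ℂ) (n : ℕ) :
    ∑ j ∈ Finset.range (n + 1), (-1) ^ j * cbinom z j = (-1) ^ n * cbinom (z - 1) n := by
  induction n with
  | zero => simp [cbinom_zero_right]
  | succ n ih =>
    rw [Finset.sum_range_succ, ih, ← cbinom_succ_sub]
    ring

theorem cbinom_eq_prod (z : ℂ) (n : ℕ) :
    (-1) ^ n * cbinom z n = (∏ j ∈ Finset.range n, (-z + j)) / n.factorial := by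
  induction n with
  | zero => simp [cbinom_zero_right]
  | succ n ih =>
    have h1 : ((n : ℂ) + 1) ≠ 0 := by exact_mod_cast n.succ_ne_zero
    have h2 : ((n.factorial : ℕ) : ℂ) ≠ 0 := by exact_mod_cast n.factorial_ne_zero
    apply mul_left_cancel₀ h1
    rw [mul_left_comm, succ_mul_cbinom_succ, Finset.prod_range_succ, Nat.factorial_succ]
    rw [eq_div_iff h2] at ih
    push_cast
    rw [← ih]
    field_simp
    ring

theorem isBigO_cbinom (z : ℂ) :
    cbinom z =O[atTop] fun n : ℕ => (n : ℝ) ^ (-z.re - 1) := by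
  by_cases hz : ∃ m : ℕ, z = m
  · obtain ⟨m, rfl⟩ := hz
    refine (isBigO_zero _ atTop).congr' ?_ .rfl
    filter_upwards [eventually_gt_atTop m] with n hn
    rw [cbinom, descPochhammer_eval_coe_nat_of_lt hn, zero_div]
  · push Not at hz
    have hΓ : Complex.Gamma (-z) ≠ 0 :=
      Complex.Gamma_ne_zero fun m h => hz m (neg_injective h)
    have hlim := (Complex.GammaSeq_tendsto_Gamma (-z)).inv₀ hΓ
    have h1 : (fun n : ℕ => (n : ℂ) ^ (-z - 1) * (Complex.GammaSeq (-z) n)⁻¹) =O[atTop]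
        fun n : ℕ => (n : ℝ) ^ (-z.re - 1) := by
      have h := (IsBigO.of_bound' (f := fun n : ℕ => (n : ℂ) ^ (-z - 1))
        (g := fun n : ℕ => (n : ℝ) ^ (-z.re - 1)) (l := atTop) ?_).mul (hlim.isBigO_one ℝ)
      · simpa using h
      · filter_upwards [eventually_gt_atTop 0] with n hn
        rw [Complex.norm_natCast_cpow_of_pos hn]
        simpa using Real.le_norm_self _
    have h2 : (fun n : ℕ => (1 - z / n)⁻¹) =O[atTop] fun _ : ℕ => (1 : ℝ) := by
      have h := ((tendsto_const_div_atTop_nhds_zero_nat z).const_sub 1).inv₀ (by simp)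
      exact h.isBigO_one ℝ
    have h3 := h1.mul h2
    simp only [mul_one] at h3
    refine IsBigO.trans (IsBigO.of_bound' ?_) h3
    filter_upwards [eventually_gt_atTop 0] with n hn
    have hn0 : (n : ℂ) ≠ 0 := by exact_mod_cast hn.ne'
    have hnz : (n : ℂ) - z ≠ 0 := sub_ne_zero.2 (hz n).symm
    have hf : ((n.factorial : ℕ) : ℂ) ≠ 0 := by exact_mod_cast n.factorial_ne_zero
    have hp : (n : ℂ) ^ (-z) ≠ 0 := by simp [Complex.cpow_eq_zero_iff, hn0]
    have heq : (n : ℂ) ^ (-z - 1) * (Complex.GammaSeq (-z) n)⁻¹ * (1 - z / n)⁻¹ =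
        (-1) ^ n * cbinom z n := by
      rw [cbinom_eq_prod, Complex.GammaSeq, inv_div, Complex.cpow_sub _ _ hn0, Complex.cpow_one,
        Finset.prod_range_succ, one_sub_div hn0, inv_div]
      have : -z + n ≠ 0 := by rwa [neg_add_eq_sub]
      field_simp
      ring
    rw [heq]
    simp

section NewtonSeries

variable {a : ℕ → ℝ} {z : ℂ}

/-- The Newton series `Σ_{n=1}^∞ (-1)^{n-1} a(n) binom(z, n)`. -/
noncomputable def newtonSeries (a : ℕ → ℝ) (z : ℂ) : ℂ :=
  ∑' n : ℕ, (-1 : ℂ) ^ n * (a (n + 1) : ℂ) * cbinom z (n + 1)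

theorem isBigO_mul_mul_cbinom
    (ha : ∀ ε : ℝ, 0 < ε → (fun n : ℕ => n * a n) =O[atTop] fun n : ℕ => (n : ℝ) ^ ε)
    (z : ℂ) {ε : ℝ} (hε : 0 < ε) :
    (fun n : ℕ => (n : ℂ) * a n * cbinom z n) =O[atTop]
      fun n : ℕ => (n : ℝ) ^ (ε + (-z.re - 1)) := by
  have h := (((Complex.isBigO_ofReal_left).2 (ha ε hε))).mul (isBigO_cbinom z)
  refine (h.congr_left fun n => by push_cast; rfl).congr' .rfl ?_
  filter_upwards [eventually_gt_atTop 0] with n hn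
  rw [Real.rpow_add (by exact_mod_cast hn)]

theorem summable_newtonSeries
    (ha : ∀ ε : ℝ, 0 < ε → (fun n : ℕ => n * a n) =O[atTop] fun n : ℕ => (n : ℝ) ^ ε)
    (hz : -1 < z.re) :
    Summable fun n : ℕ => (-1 : ℂ) ^ n * (a (n + 1) : ℂ) * cbinom z (n + 1) := by
  have hε : 0 < (z.re + 1) / 2 := by linarith
  have h1 : (fun n : ℕ => (a n : ℂ) * cbinom z n) =O[atTop]
      fun n : ℕ => (n : ℝ) ^ ((z.re + 1) / 2 + (-z.re - 1) - 1) := by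
    have hinv : (fun n : ℕ => ((n : ℂ))⁻¹) =O[atTop] fun n : ℕ => ((n : ℝ))⁻¹ :=
      IsBigO.of_bound' (Eventually.of_forall fun n => by simp)
    refine ((isBigO_mul_mul_cbinom ha z hε).mul hinv).congr' ?_ ?_
    · filter_upwards [eventually_gt_atTop 0] with n hn
      have : (n : ℂ) ≠ 0 := by exact_mod_cast hn.ne'
      field_simp
    · filter_upwards [eventually_gt_atTop 0] with n hn
      rw [Real.rpow_sub_one (by positivity)]
      exact (div_eq_mul_inv _ _).symm
  have h2 : Summable fun n : ℕ => ‖(a n : ℂ) * cbinom z n‖ :=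
    summable_of_isBigO_nat (Real.summable_nat_rpow.2 (by linarith)) h1.norm_left
  refine Summable.of_norm (((summable_nat_add_iff 1).2 h2).congr fun n => ?_)
  simp

theorem hasSum_newtonSeries_sub
    (ha : ∀ ε : ℝ, 0 < ε → (fun n : ℕ => n * a n) =O[atTop] fun n : ℕ => (n : ℝ) ^ ε)
    (hz : 0 < z.re) :
    HasSum (fun n : ℕ => (-1 : ℂ) ^ n * (a (n + 1) : ℂ) * cbinom (z - 1) n)
      (newtonSeries a z - newtonSeries a (z - 1)) := by
  have h1 := (summable_newtonSeries ha (z := z) (by linarith)).hasSum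
  have h2 := (summable_newtonSeries ha (z := z - 1) (by simpa using hz)).hasSum
  refine (h1.sub h2).congr_fun fun n => ?_
  rw [← mul_sub, cbinom_succ_sub]

theorem hasSum_mul_newtonSeries_sub
    (ha : ∀ ε : ℝ, 0 < ε → (fun n : ℕ => n * a n) =O[atTop] fun n : ℕ => (n : ℝ) ^ ε)
    (hz : 0 < z.re) :
    HasSum (fun n : ℕ => (-1 : ℂ) ^ n * (((n + 1 : ℕ) : ℝ) * a (n + 1) : ℝ) * cbinom z (n + 1))
      (z * (newtonSeries a z - newtonSeries a (z - 1))) := by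
  refine ((hasSum_newtonSeries_sub ha hz).mul_left z).congr_fun fun n => ?_
  have := succ_mul_cbinom_succ' z n
  push_cast
  linear_combination ((-1 : ℂ) ^ n * a (n + 1)) * this

theorem mul_newtonSeries_sub_of_mul_eq {b : ℕ → ℝ}
    (ha : ∀ ε : ℝ, 0 < ε → (fun n : ℕ => n * a n) =O[atTop] fun n : ℕ => (n : ℝ) ^ ε)
    (hab : ∀ n : ℕ, 0 < n → n * a n = b n) (hz : 0 < z.re) :
    z * (newtonSeries a z - newtonSeries a (z - 1)) = newtonSeries b z := by
  rw [← (hasSum_mul_newtonSeries_sub ha hz).tsum_eq, newtonSeries]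
  exact tsum_congr fun n => by rw [hab _ n.succ_pos]

theorem tendsto_cbinom_sub_one (hz : 0 < z.re) :
    Tendsto (fun n : ℕ => (-1) ^ n * cbinom (z - 1) n) atTop (𝓝 0) := by
  have h1 : (fun n : ℕ => (-1) ^ n * cbinom (z - 1) n) =O[atTop]
      fun n : ℕ => (n : ℝ) ^ (-z.re) :=
    (IsBigO.of_bound' (g := cbinom (z - 1)) (Eventually.of_forall fun n => by simp)).trans
      (by simpa using isBigO_cbinom (z - 1))
  exact h1.trans_tendsto ((tendsto_rpow_neg_atTop hz).comp tendsto_natCast_atTop_atTop)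

theorem tsum_neg_one_pow_mul_cbinom_succ (hz : 0 < z.re)
    (hs : Summable fun n : ℕ => (-1 : ℂ) ^ n * cbinom z (n + 1)) :
    ∑' n : ℕ, (-1 : ℂ) ^ n * cbinom z (n + 1) = 1 := by
  refine tendsto_nhds_unique hs.hasSum.tendsto_sum_nat ?_
  have h := (tendsto_cbinom_sub_one hz).const_sub 1
  rw [sub_zero] at h
  refine h.congr fun n => ?_
  rw [← sum_neg_one_pow_mul_cbinom, Finset.sum_range_succ', cbinom_zero_right, pow_zero, one_mul,
    sub_add_cancel_right, ← Finset.sum_neg_distrib]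
  exact Finset.sum_congr rfl fun i _ => by ring

theorem mul_newtonSeries_sub_eq_one
    (ha : ∀ ε : ℝ, 0 < ε → (fun n : ℕ => n * a n) =O[atTop] fun n : ℕ => (n : ℝ) ^ ε)
    (ha1 : ∀ n : ℕ, 0 < n → n * a n = 1) (hz : 0 < z.re) :
    z * (newtonSeries a z - newtonSeries a (z - 1)) = 1 := by
  have h := (hasSum_mul_newtonSeries_sub ha hz).congr_fun
    (g := fun n : ℕ => (-1 : ℂ) ^ n * cbinom z (n + 1))
    fun n => by rw [ha1 _ n.succ_pos]; simp
  rw [← h.tsum_eq, tsum_neg_one_pow_mul_cbinom_succ hz h.summable]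

/-- Summation by parts: the partial sums of `(-1)ⁿ binom(z, n)` are `(-1)ⁿ binom(z-1, n)`. -/
theorem sum_range_summation_by_parts (b : ℕ → ℝ) (z : ℂ) (N : ℕ) :
    ∑ n ∈ Finset.range N, (-1 : ℂ) ^ n * (b (n + 1) : ℂ) * cbinom (z - 1) n =
      (∑ m ∈ Finset.Icc 1 N, b m : ℝ) * ((-1) ^ N * cbinom (z - 1) N) +
      ∑ n ∈ Finset.range N, (-1 : ℂ) ^ n * (∑ m ∈ Finset.Icc 1 (n + 1), b m : ℝ) *
        cbinom z (n + 1) := by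
  induction N with
  | zero => simp
  | succ N ih =>
    rw [Finset.sum_range_succ, Finset.sum_range_succ, ih,
      Finset.sum_Icc_succ_top (by omega : 1 ≤ N + 1)]
    have := cbinom_succ_sub z N
    push_cast
    linear_combination (-(-1 : ℂ) ^ N * (∑ m ∈ Finset.Icc 1 N, (b m : ℂ) + b (N + 1))) * this

theorem newtonSeries_sub_eq_mul_newtonSeries_sub {b : ℕ → ℝ}
    (ha : ∀ ε : ℝ, 0 < ε → (fun n : ℕ => n * a n) =O[atTop] fun n : ℕ => (n : ℝ) ^ ε)
    (hb : ∀ ε : ℝ, 0 < ε → (fun n : ℕ => n * b n) =O[atTop] fun n : ℕ => (n : ℝ) ^ ε)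
    (hab : ∀ n : ℕ, 0 < n → n * a n = ∑ m ∈ Finset.Icc 1 n, b m) (hz : 0 < z.re) :
    z * (newtonSeries a z - newtonSeries a (z - 1)) =
      newtonSeries b z - newtonSeries b (z - 1) := by
  have h1 := (hasSum_mul_newtonSeries_sub ha hz).tendsto_sum_nat
  have h2 := (hasSum_newtonSeries_sub hb hz).tendsto_sum_nat
  have h3 : Tendsto (fun N : ℕ => (N : ℂ) * a N * cbinom (z - 1) N) atTop (𝓝 0) := by
    refine (isBigO_mul_mul_cbinom ha (z - 1) (half_pos hz)).trans_tendsto ?_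
    have : z.re / 2 + (-(z - 1).re - 1) = -(z.re / 2) := by simp; ring
    rw [this]
    exact (tendsto_rpow_neg_atTop (half_pos hz)).comp tendsto_natCast_atTop_atTop
  have h4 : Tendsto (fun N : ℕ => (-1 : ℂ) ^ N * ((N : ℂ) * a N * cbinom (z - 1) N))
      atTop (𝓝 0) :=
    squeeze_zero_norm (fun N => by simp) (tendsto_zero_iff_norm_tendsto_zero.1 h3)
  have h5 := h4.add h1
  rw [zero_add] at h5
  refine tendsto_nhds_unique (h5.congr' ?_) h2
  filter_upwards [eventually_gt_atTop 0] with N hN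
  rw [sum_range_summation_by_parts, ← hab N hN]
  congr 1
  · push_cast; ring
  · exact Finset.sum_congr rfl fun n _ => by rw [hab _ n.succ_pos]

end NewtonSeries

theorem F_eq_newtonSeries {k : List ℕ} (hk : k ≠ []) (z : ℂ) :
    F k z = newtonSeries (sStar (hdual k)) z := by
  rw [F, if_neg hk, newtonSeries]

theorem pow_mul_F_sub (l : List ℕ) (hl : ∀ x ∈ l, 0 < x) (a : ℕ) (ha : 1 ≤ a)
    (z : ℂ) (hz : 0 < z.re) :
    z ^ a * (F (l ++ [a]) z - F (l ++ [a]) (z - 1)) = F l z := by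
  have hO : ∀ a, 1 ≤ a → ∀ ε : ℝ, 0 < ε →
      (fun n : ℕ => n * sStar (hdual (l ++ [a])) n) =O[atTop] fun n : ℕ => (n : ℝ) ^ ε := by
    intro a ha
    refine isBigO_mul_sStar_hdual _ (by simp) ?_
    simp only [List.mem_append, List.mem_singleton]
    rintro x (hx | rfl)
    exacts [hl x hx, ha]
  rw [F_eq_newtonSeries (by simp), F_eq_newtonSeries (by simp)]
  induction a, ha using Nat.le_induction with
  | base =>
    rw [pow_one]
    rcases eq_or_ne l [] with rfl | hne
    · rw [F, if_pos rfl]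
      exact mul_newtonSeries_sub_eq_one (hO 1 le_rfl) mul_sStar_hdual_singleton_one hz
    · rw [F_eq_newtonSeries hne]
      exact mul_newtonSeries_sub_of_mul_eq (hO 1 le_rfl) (mul_sStar_hdual_append_one l hne) hz
  | succ a ha ih =>
    rw [← ih, pow_succ, mul_assoc, newtonSeries_sub_eq_mul_newtonSeries_sub (hO _ (by omega))
      (hO a ha) (mul_sStar_hdual_append_succ l a hl ha) hz]

/-- Difference equation:
`F_k(z) - F_k(z-1) = F_{k₋}(z)/z^{k_r}` for `Re(z) > 0`. -/
theorem F_difference_equation (k : List ℕ) (hk : k ≠ []) (hpos : ∀ x ∈ k, 0 < x)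
    (z : ℂ) (hz : 0 < z.re) :
    F k z - F k (z - 1) = F k.dropLast z / z ^ (k.getLast hk) := by
  have hz0 : z ≠ 0 := by
    rintro rfl
    simp at hz
  have h := pow_mul_F_sub k.dropLast (fun x hx => hpos x (List.mem_of_mem_dropLast hx))
    (k.getLast hk) (hpos _ (List.getLast_mem hk)) z hz
  rw [List.dropLast_append_getLast] at h
  rw [eq_div_iff (pow_ne_zero _ hz0), mul_comm, h]

end Kawashima
end

section
/- (Kawashima's fraction series, second form.) Let k be a nonempty index, k∨ its Hoffman dual, and rev(k∨) the reversal of k∨. Then for all z∈ℂ with Re(z)>−1, F_k(z) = G_{rev(k∨)}(z). -/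
open MeasureTheory Filter Topology

namespace Kawashima

section Connector

variable {𝕜 : Type*} [RCLike 𝕜]

/-- The connector `∏_{i < m} (i - z) / (N + i + 1)`, equal to
`(-1)^m binom(z, m) / binom(N + m, m)`. -/
noncomputable def conn (z : 𝕜) (m N : ℕ) : 𝕜 :=
  ∏ i ∈ Finset.range m, ((i : 𝕜) - z) / ((N : 𝕜) + i + 1)

lemma hasSum_of_forall_eq {ι E : Type*} [AddCommMonoid E] [TopologicalSpace E] {f g : ι → E}
    {a : E} (hf : HasSum f a) (h : ∀ i, f i = g i) : HasSum g a :=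
  funext h ▸ hf

lemma natCast_add_add_one_ne_zero (N m : ℕ) : (N : 𝕜) + m + 1 ≠ 0 := by
  exact_mod_cast Nat.succ_ne_zero (N + m)

lemma conn_succ_left (z : 𝕜) (m N : ℕ) :
    conn z (m + 1) N = conn z m N * (((m : 𝕜) - z) / ((N : 𝕜) + m + 1)) :=
  Finset.prod_range_succ _ _

lemma conn_succ_right (z : 𝕜) (m N : ℕ) :
    conn z m (N + 1) * ((N : 𝕜) + 1 + m) = conn z m N * ((N : 𝕜) + 1) := by
  induction m with
  | zero => simp [conn]
  | succ m ih =>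
    have h1 := natCast_add_add_one_ne_zero (𝕜 := 𝕜) N m
    have h2 := natCast_add_add_one_ne_zero (𝕜 := 𝕜) (N + 1) m
    rw [conn_succ_left, conn_succ_left]
    push_cast at h2 ⊢
    field_simp
    linear_combination ((N : 𝕜) + m + 2) * ((m : 𝕜) - z) * ih

lemma conn_sub_conn_right (z : 𝕜) {m : ℕ} (hm : m ≠ 0) (N : ℕ) :
    conn z m N / m - conn z m (N + 1) / m = conn z m (N + 1) / ((N : 𝕜) + 1) := by
  have hm' : (m : 𝕜) ≠ 0 := Nat.cast_ne_zero.2 hm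
  have hN : (N : 𝕜) + 1 ≠ 0 := Nat.cast_add_one_ne_zero N
  field_simp
  linear_combination -conn_succ_right z m N

lemma conn_sub_conn_left (z : 𝕜) (m N : ℕ) (hz : (N : 𝕜) + 1 + z ≠ 0) :
    conn z m N / ((N : 𝕜) + 1 + z) - conn z (m + 1) N / ((N : 𝕜) + 1 + z)
      = conn z m (N + 1) / ((N : 𝕜) + 1) := by
  have hN : (N : 𝕜) + 1 ≠ 0 := Nat.cast_add_one_ne_zero N
  have h1 := natCast_add_add_one_ne_zero (𝕜 := 𝕜) N m
  have h := conn_succ_right z m N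
  rw [conn_succ_left]
  field_simp
  linear_combination -((N : 𝕜) + 1 + z) * h

lemma conn_nonneg {x : ℝ} (hx : x < 0) (m N : ℕ) : 0 ≤ conn x m N :=
  Finset.prod_nonneg fun i _ => div_nonneg (by have := Nat.cast_nonneg (α := ℝ) i; linarith)
    (by positivity)

lemma conn_mul_le {x : ℝ} (hx : x < 0) {m : ℕ} (hm : m ≠ 0) (N : ℕ) :
    conn x m N * ((N : ℝ) + 1) ≤ conn x m 0 := by
  induction N with
  | zero => simp
  | succ N ih =>
    have h := conn_succ_right x m N
    have hm' : (1 : ℝ) ≤ m := by exact_mod_cast Nat.one_le_iff_ne_zero.2 hm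
    have h0 := conn_nonneg hx m (N + 1)
    push_cast
    nlinarith

/-- `z` has real part at least `x` and its Pochhammer products are dominated by those of `x`,
where `-1 < x < 0`. -/
structure Dominated (z : 𝕜) (x K : ℝ) : Prop where
  neg_one_lt : -1 < x
  lt_zero : x < 0
  le_re : x ≤ RCLike.re z
  norm_prod_le : ∀ m, ‖∏ i ∈ Finset.range m, ((i : 𝕜) - z)‖
    ≤ K * ∏ i ∈ Finset.range m, ((i : ℝ) - x)

lemma Dominated.refl {x : ℝ} (h : -1 < x) (h' : x < 0) : Dominated x x 1 where
  neg_one_lt := h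
  lt_zero := h'
  le_re := le_rfl
  norm_prod_le m := by
    rw [one_mul, Real.norm_of_nonneg]
    exact Finset.prod_nonneg fun i _ => by have := Nat.cast_nonneg (α := ℝ) i; linarith

variable {z : 𝕜} {x K : ℝ}

lemma Dominated.nonneg (h : Dominated z x K) : 0 ≤ K := by
  simpa using (norm_nonneg _).trans (h.norm_prod_le 0)

lemma Dominated.real (h : Dominated z x K) : Dominated x x 1 :=
  .refl h.neg_one_lt h.lt_zero

lemma Dominated.le_norm (h : Dominated z x K) (n : ℕ) : (n : ℝ) + x ≤ ‖(n : 𝕜) + z‖ := by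
  refine le_trans ?_ (RCLike.re_le_norm _)
  simpa using h.le_re

lemma Dominated.add_pos (h : Dominated z x K) (N : ℕ) : 0 < (N : ℝ) + 1 + x := by
  have := h.neg_one_lt
  have := Nat.cast_nonneg (α := ℝ) N
  linarith

lemma Dominated.le_norm_succ (h : Dominated z x K) (N : ℕ) :
    (N : ℝ) + 1 + x ≤ ‖(N : 𝕜) + 1 + z‖ := by
  simpa using h.le_norm (N + 1)

lemma Dominated.add_ne_zero (h : Dominated z x K) (N : ℕ) : (N : 𝕜) + 1 + z ≠ 0 :=
  norm_pos_iff.1 ((h.add_pos N).trans_le (h.le_norm_succ N))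

lemma Dominated.norm_conn_le (h : Dominated z x K) (m N : ℕ) :
    ‖conn z m N‖ ≤ K * conn x m N := by
  have hp : ∏ i ∈ Finset.range m, ‖(N : 𝕜) + i + 1‖ =
      ∏ i ∈ Finset.range m, ((N : ℝ) + i + 1) := by
    refine Finset.prod_congr rfl fun i _ => ?_
    have : ((N : 𝕜) + i + 1) = ((N + i + 1 : ℕ) : 𝕜) := by push_cast; ring
    rw [this, RCLike.norm_natCast]
    push_cast; ring
  unfold conn
  rw [Finset.prod_div_distrib, Finset.prod_div_distrib, norm_div, ← mul_div_assoc,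
    norm_prod (Finset.range m) (fun i => (N : 𝕜) + i + 1), hp]
  have := h.norm_prod_le m
  gcongr

lemma hasSum_sub_succ {f : ℕ → 𝕜} {h : ℕ → ℝ} {l : ℝ} (hf : Tendsto f atTop (𝓝 0))
    (hh : Tendsto h atTop (𝓝 l)) (hb : ∀ j, ‖f j - f (j + 1)‖ ≤ h j - h (j + 1)) :
    HasSum (fun j => f j - f (j + 1)) (f 0) := by
  have hs : Summable fun j => h j - h (j + 1) := by
    refine ((hasSum_iff_tendsto_nat_of_nonneg
      (fun j => (norm_nonneg _).trans (hb j)) (h 0 - l)).2 ?_).summable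
    simp only [Finset.sum_range_sub']
    exact hh.const_sub _
  rw [(Summable.of_norm_bounded hs hb).hasSum_iff_tendsto_nat]
  simp only [Finset.sum_range_sub']
  simpa using hf.const_sub (f 0)

lemma hasSum_ite_le {f : ℕ → 𝕜} {a : 𝕜} {M : ℕ} (h : HasSum (fun j => f (M + j)) a) :
    HasSum (fun n => if M ≤ n then f n else 0) a := by
  have hi : Function.Injective fun j : ℕ => M + j := add_right_injective M
  refine (hi.hasSum_iff ?_).1 ?_
  · intro n hn
    refine if_neg fun hle => hn ⟨n - M, ?_⟩
    simp only; omega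
  · simpa [Function.comp_def] using h

lemma Dominated.tendsto_conn_right (h : Dominated z x K) {m : ℕ} (hm : m ≠ 0) :
    Tendsto (conn z m) atTop (𝓝 0) := by
  have h0 : Tendsto (fun N : ℕ => K * conn x m 0 * (1 / ((N : ℝ) + 1))) atTop (𝓝 0) := by
    simpa using (tendsto_one_div_add_atTop_nhds_zero_nat (𝕜 := ℝ)).const_mul (K * conn x m 0)
  refine squeeze_zero_norm (fun N => (h.norm_conn_le m N).trans ?_) h0
  rw [mul_assoc, mul_one_div]
  refine mul_le_mul_of_nonneg_left ?_ h.nonneg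
  rw [le_div_iff₀ (by positivity)]
  exact conn_mul_le h.lt_zero hm N

lemma conn_sub_succ_left (x : ℝ) (m N : ℕ) :
    conn x m N - conn x (m + 1) N = conn x m N * ((N : ℝ) + 1 + x) / ((N : ℝ) + m + 1) := by
  have h1 := natCast_add_add_one_ne_zero (𝕜 := ℝ) N m
  rw [conn_succ_left]
  field_simp
  ring

lemma Dominated.antitone_conn (h : Dominated z x K) (N : ℕ) :
    Antitone fun m => conn x m N := by
  refine antitone_nat_of_succ_le fun m => sub_nonneg.1 ?_
  rw [conn_sub_succ_left]
  have := conn_nonneg h.lt_zero m N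
  have := h.add_pos N
  positivity

lemma Dominated.tendsto_conn_real (h : Dominated z x K) (N : ℕ) :
    Tendsto (fun m => conn x m N) atTop (𝓝 0) := by
  have hbdd : BddBelow (Set.range fun m => conn x m N) :=
    ⟨0, by rintro _ ⟨m, rfl⟩; exact conn_nonneg h.lt_zero m N⟩
  have hl := tendsto_atTop_ciInf (h.antitone_conn N) hbdd
  set l := ⨅ m, conn x m N with hl_def
  have hl0 : 0 ≤ l := le_ciInf fun m => conn_nonneg h.lt_zero m N
  have hle : ∀ m, l ≤ conn x m N := fun m => ciInf_le hbdd m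
  rcases hl0.eq_or_lt with h0 | h0
  · rwa [← h0] at hl
  exfalso
  have hN := h.add_pos N
  have hs : Summable fun m => conn x m N - conn x (m + 1) N := by
    refine ((hasSum_iff_tendsto_nat_of_nonneg
      (fun j => sub_nonneg.2 (h.antitone_conn N j.le_succ)) (conn x 0 N - l)).2 ?_).summable
    simp only [Finset.sum_range_sub']
    exact hl.const_sub _
  have hs' : Summable fun m : ℕ => (l * ((N : ℝ) + 1 + x)) * (1 / ((m + (N + 1) : ℕ) : ℝ)) := by
    refine Summable.of_nonneg_of_le (fun m => by positivity) (fun m => ?_) hs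
    rw [conn_sub_succ_left, mul_one_div]
    have : ((m + (N + 1) : ℕ) : ℝ) = (N : ℝ) + m + 1 := by push_cast; ring
    rw [this]
    have := hle m
    gcongr
  rw [summable_mul_left_iff (by positivity)] at hs'
  exact Real.not_summable_one_div_natCast
    ((summable_nat_add_iff (f := fun n : ℕ => 1 / (n : ℝ)) (N + 1)).1 hs')

lemma Dominated.tendsto_conn_left (h : Dominated z x K) (N : ℕ) :
    Tendsto (fun m => conn z m N) atTop (𝓝 0) :=
  squeeze_zero_norm (fun m => h.norm_conn_le m N)
    (by simpa using (h.tendsto_conn_real N).const_mul K)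

/-- Transport of a factor `1 / m` through the connector. -/
lemma Dominated.hasSum_conn_div (h : Dominated z x K) {m : ℕ} (hm : m ≠ 0) (N : ℕ) :
    HasSum (fun n : ℕ => if N + 1 ≤ n then conn z m n / n else 0) (conn z m N / m) := by
  refine hasSum_ite_le (f := fun n : ℕ => conn z m n / n) ?_
  have key := hasSum_sub_succ (f := fun j => conn z m (N + j) / m)
    (h := fun j => K * (conn x m (N + j) / m)) (l := 0) ?_ ?_ ?_
  · convert key using 2 with j
    · have e := conn_sub_conn_right z hm (N + j)
      rw [← add_assoc N j 1, e, add_right_comm N 1 j]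
      push_cast; ring
    · rfl
  · have := ((tendsto_add_atTop_iff_nat N).2 (h.tendsto_conn_right hm)).div_const (m : 𝕜)
    simpa [add_comm] using this
  · have := (((tendsto_add_atTop_iff_nat N).2 (h.real.tendsto_conn_right hm)).div_const
      (m : ℝ)).const_mul K
    simpa [add_comm] using this
  · intro j
    rw [← add_assoc, conn_sub_conn_right z hm, ← mul_sub, conn_sub_conn_right x hm, norm_div,
      ← mul_div_assoc]
    have hn : ‖((N + j : ℕ) : 𝕜) + 1‖ = ((N + j : ℕ) : ℝ) + 1 := by
      rw [← Nat.cast_add_one, RCLike.norm_natCast]; push_cast; rfl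
    rw [hn]
    have := h.norm_conn_le m (N + j + 1)
    gcongr

lemma Dominated.norm_conn_div_le (h : Dominated z x K) (M n : ℕ) :
    ‖conn z M n / ((n : 𝕜) + 1 + z)‖ ≤ K * (conn x M n / ((n : ℝ) + 1 + x)) := by
  rw [norm_div, ← mul_div_assoc]
  have := h.norm_conn_le M n
  have := h.add_pos n
  have := h.le_norm_succ n
  have := mul_nonneg h.nonneg (conn_nonneg h.lt_zero M n)
  gcongr

lemma Dominated.hasSum_conn_left (h : Dominated z x K) (M n : ℕ) :
    HasSum (fun m : ℕ => if M ≤ m then conn z m (n + 1) / ((n : 𝕜) + 1) else 0)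
      (conn z M n / ((n : 𝕜) + 1 + z)) := by
  refine hasSum_ite_le (f := fun m : ℕ => conn z m (n + 1) / ((n : 𝕜) + 1)) ?_
  have key := hasSum_sub_succ (f := fun j => conn z (M + j) n / ((n : 𝕜) + 1 + z))
    (h := fun j => K * (conn x (M + j) n / ((n : ℝ) + 1 + x))) (l := 0) ?_ ?_ ?_
  · convert key using 2 with j
    · exact (conn_sub_conn_left z (M + j) n (h.add_ne_zero n)).symm
    · rfl
  · have := ((tendsto_add_atTop_iff_nat M).2 (h.tendsto_conn_left n)).div_const ((n : 𝕜) + 1 + z)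
    simpa [add_comm M] using this
  · have := (((tendsto_add_atTop_iff_nat M).2 (h.tendsto_conn_real n)).div_const
      ((n : ℝ) + 1 + x)).const_mul K
    simpa [add_comm M] using this
  · intro j
    rw [← add_assoc, conn_sub_conn_left z _ _ (h.add_ne_zero n), ← mul_sub,
      conn_sub_conn_left x _ _ (h.add_pos n).ne', norm_div, ← mul_div_assoc]
    have hn : ‖(n : 𝕜) + 1‖ = (n : ℝ) + 1 := by
      rw [← Nat.cast_add_one, RCLike.norm_natCast]; push_cast; rfl
    rw [hn]
    have := h.norm_conn_le (M + j) (n + 1)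
    gcongr

/-- The tail `∑_{m ≥ M} conn z m N / m`. -/
noncomputable def connTail (z : 𝕜) (M N : ℕ) : 𝕜 :=
  ∑' m : ℕ, if M ≤ m then conn z m N / m else 0

lemma Dominated.hasSum_connTail_real_le (h : Dominated z x K) {M : ℕ} (hM : M ≠ 0) (N : ℕ) :
    HasSum (fun m : ℕ => if M ≤ m then conn x m N / m else 0) (connTail x M N) ∧
      connTail x M N ≤ ((N : ℝ) + 2) / (1 + x) * conn x M N := by
  have hx : 0 < 1 + x := by linarith [h.neg_one_lt]
  have hd : HasSum (fun m : ℕ => if M ≤ m then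
      ((N : ℝ) + 2) / (1 + x) * (conn x m N - conn x (m + 1) N) else 0)
      (((N : ℝ) + 2) / (1 + x) * conn x M N) := by
    refine hasSum_ite_le (f := fun m : ℕ =>
      ((N : ℝ) + 2) / (1 + x) * (conn x m N - conn x (m + 1) N)) (HasSum.mul_left _ ?_)
    refine hasSum_sub_succ (f := fun j => conn x (M + j) N) (h := fun j => conn x (M + j) N)
      (l := 0) ?_ ?_ fun j => ?_
    · simpa [add_comm M] using (tendsto_add_atTop_iff_nat M).2 (h.tendsto_conn_real N)
    · simpa [add_comm M] using (tendsto_add_atTop_iff_nat M).2 (h.tendsto_conn_real N)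
    · rw [Real.norm_of_nonneg]
      exact sub_nonneg.2 (h.antitone_conn N (by omega))
  have hle : ∀ m : ℕ, (if M ≤ m then conn x m N / m else 0) ≤ if M ≤ m then
      ((N : ℝ) + 2) / (1 + x) * (conn x m N - conn x (m + 1) N) else 0 := by
    intro m
    split_ifs with hm
    · have hm1 : (1 : ℝ) ≤ m := by exact_mod_cast (Nat.one_le_iff_ne_zero.2 hM).trans hm
      have hc := conn_nonneg h.lt_zero m N
      have hN := Nat.cast_nonneg (α := ℝ) N
      rw [conn_sub_succ_left, div_mul_div_comm, div_le_div_iff₀ (by positivity) (by positivity)]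
      have : (1 + x) * ((N : ℝ) + m + 1) ≤ (N + 2) * (N + 1 + x) * m := by
        have e1 : (N : ℝ) + m + 1 ≤ (N + 2) * m := by nlinarith
        have e2 : (1 + x) * ((N : ℝ) + m + 1) ≤ (1 + x) * ((N + 2) * m) := by gcongr
        nlinarith [mul_nonneg hN (mul_nonneg (by positivity : (0 : ℝ) ≤ N + 2)
          (by positivity : (0 : ℝ) ≤ m))]
      nlinarith
    · exact le_rfl
  have hs : Summable fun m : ℕ => if M ≤ m then conn x m N / m else 0 := by
    refine Summable.of_nonneg_of_le (fun m => ?_) hle hd.summable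
    have hc := conn_nonneg h.lt_zero m N
    split_ifs <;> positivity
  exact ⟨hs.hasSum, hasSum_le hle hs.hasSum hd⟩

lemma Dominated.norm_ite_conn_div_le (h : Dominated z x K) (M N m : ℕ) :
    ‖if M ≤ m then conn z m N / m else 0‖ ≤ K * if M ≤ m then conn x m N / m else 0 := by
  split_ifs
  · rw [norm_div, RCLike.norm_natCast, ← mul_div_assoc]
    have := h.norm_conn_le m N
    gcongr
  · simp

lemma Dominated.hasSum_connTail (h : Dominated z x K) {M : ℕ} (hM : M ≠ 0) (N : ℕ) :
    HasSum (fun m : ℕ => if M ≤ m then conn z m N / m else 0) (connTail z M N) :=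
  (Summable.of_norm_bounded ((h.hasSum_connTail_real_le hM N).1.summable.mul_left K)
    (h.norm_ite_conn_div_le M N)).hasSum

lemma Dominated.connTail_sub_succ (h : Dominated z x K) {M : ℕ} (hM : M ≠ 0) (N : ℕ) :
    connTail z M N - connTail z M (N + 1) = conn z M N / ((N : 𝕜) + 1 + z) := by
  refine HasSum.unique (hasSum_of_forall_eq
    ((h.hasSum_connTail hM N).sub (h.hasSum_connTail hM (N + 1))) fun m => ?_) (h.hasSum_conn_left M N)
  split_ifs with hm
  · exact conn_sub_conn_right z (by omega) N
  · simp

lemma Dominated.tendsto_connTail (h : Dominated z x K) {M : ℕ} (hM : M ≠ 0) :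
    Tendsto (connTail z M) atTop (𝓝 0) := by
  have h0 : Tendsto (fun N : ℕ => K * connTail x M 0 * (1 / ((N : ℝ) + 1))) atTop (𝓝 0) := by
    simpa using (tendsto_one_div_add_atTop_nhds_zero_nat (𝕜 := ℝ)).const_mul (K * connTail x M 0)
  refine squeeze_zero_norm (fun N => ?_) h0
  have hR := (h.hasSum_connTail_real_le hM 0).1.mul_left K
  refine ((h.hasSum_connTail hM N).norm_le_of_bounded
    (hR.mul_right (1 / ((N : ℝ) + 1))) fun m => ?_)
  refine (h.norm_ite_conn_div_le M N m).trans ?_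
  rw [mul_assoc]
  refine mul_le_mul_of_nonneg_left ?_ h.nonneg
  split_ifs with hm
  · rw [mul_one_div, le_div_iff₀ (by positivity), div_mul_eq_mul_div]
    have := conn_mul_le h.lt_zero (show m ≠ 0 by omega) N
    gcongr
  · simp

/-- Transport of a summation `∑_{m ≥ M} 1 / m` through the connector. -/
lemma Dominated.hasSum_conn_div_add (h : Dominated z x K) {M : ℕ} (hM : M ≠ 0) (N : ℕ) :
    HasSum (fun n : ℕ => if N + 1 ≤ n then conn z M (n - 1) / ((n : 𝕜) + z) else 0)
      (connTail z M N) := by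
  refine hasSum_ite_le (f := fun n : ℕ => conn z M (n - 1) / ((n : 𝕜) + z)) ?_
  have key := hasSum_sub_succ (f := fun j => connTail z M (N + j))
    (h := fun j => K * connTail x M (N + j)) (l := 0) ?_ ?_ ?_
  · convert key using 2 with j
    · rw [← add_assoc N j 1, h.connTail_sub_succ hM, show N + 1 + j - 1 = N + j by omega]
      push_cast; ring
    · rfl
  · simpa [add_comm N] using (tendsto_add_atTop_iff_nat N).2 (h.tendsto_connTail hM)
  · simpa [add_comm N] using
      ((tendsto_add_atTop_iff_nat N).2 (h.real.tendsto_connTail hM)).const_mul K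
  · intro j
    rw [← add_assoc, h.connTail_sub_succ hM, ← mul_sub, h.real.connTail_sub_succ hM]
    exact h.norm_conn_div_le M (N + j)

end Connector

section Words

variable {𝕜 : Type*} [RCLike 𝕜]

/-- Iterated star sums attached to a word: the letter `false` divides by `m`, the letter `true`
sums up to `m` and then divides by `m`. -/
noncomputable def starSum : List Bool → ℕ → ℝ
  | [], m => if m = 1 then 1 else 0
  | false :: w, m => starSum w m / m
  | true :: w, m => (∑ i ∈ Finset.range (m + 1), starSum w i) / m

/-- The factor attached to a letter in the fraction series. -/
noncomputable def fracFactor (z : 𝕜) (b : Bool) (n : ℕ) : 𝕜 :=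
  if b then 1 / ((n : 𝕜) + z) else 1 / (n : 𝕜)

/-- The strict lower bound for the successor of `n` in the fraction series. -/
def nextBound (b : Bool) (n : ℕ) : ℕ :=
  if b then n - 1 else n

/-- The fraction series of a word over chains starting above `N`. -/
noncomputable def fracSum (z : 𝕜) : List Bool → ℕ → 𝕜
  | [], N => -z / ((N : 𝕜) + 1)
  | b :: w, N => ∑' n, if N + 1 ≤ n then fracFactor z b n * fracSum z w (nextBound b n) else 0

lemma starSum_nonneg (w : List Bool) (m : ℕ) : 0 ≤ starSum w m := by
  induction w generalizing m with
  | nil => unfold starSum; split_ifs <;> norm_num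
  | cons b w ih =>
    cases b
    · exact div_nonneg (ih m) (Nat.cast_nonneg m)
    · exact div_nonneg (Finset.sum_nonneg fun i _ => ih i) (Nat.cast_nonneg m)

lemma starSum_zero (w : List Bool) : starSum w 0 = 0 := by
  rcases w with _ | ⟨_ | _, w⟩ <;> simp [starSum]

lemma summable_uncurry_of_bound {ι κ : Type*} {f : ι → κ → 𝕜} {b : ι → κ → ℝ} {β : ι → ℝ}
    (hfb : ∀ i j, ‖f i j‖ ≤ b i j) (hb : ∀ i, HasSum (b i) (β i)) (hβ : Summable β) :
    Summable fun p : ι × κ => f p.1 p.2 := by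
  refine Summable.of_norm_bounded (g := fun p : ι × κ => b p.1 p.2) ?_ fun p => hfb p.1 p.2
  refine (summable_prod_of_nonneg fun p => (norm_nonneg _).trans (hfb p.1 p.2)).2
    ⟨fun i => (hb i).summable, ?_⟩
  simpa only [(hb _).tsum_eq] using hβ

lemma hasSum_swap {ι κ : Type*} {f : ι → κ → 𝕜} {b : ι → κ → ℝ} {β : ι → ℝ} {φ : ι → 𝕜}
    {ψ : κ → 𝕜} (hfb : ∀ i j, ‖f i j‖ ≤ b i j) (hb : ∀ i, HasSum (b i) (β i)) (hβ : Summable β)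
    (hφ : ∀ i, HasSum (f i) (φ i)) (hψ : ∀ j, HasSum (fun i => f i j) (ψ j)) :
    HasSum φ (∑' j, ψ j) ∧ Summable ψ := by
  have hs := summable_uncurry_of_bound hfb hb hβ
  have h1 := hs.hasSum.prod_fiberwise hφ
  have h2 := ((Equiv.prodComm κ ι).hasSum_iff.2 hs.hasSum).prod_fiberwise hψ
  exact ⟨h2.tsum_eq ▸ h1, h2.summable⟩

variable {z : 𝕜} {x K : ℝ}

lemma hasSum_starSum_mul_connTail_left (z : 𝕜) (N m : ℕ) (w : List Bool) :
    HasSum (fun i : ℕ => if i ≤ m then (starSum w i : 𝕜) * (conn z m N / m) else 0)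
      ((starSum (true :: w) m : 𝕜) * conn z m N) := by
  have e : ((starSum (true :: w) m : ℝ) : 𝕜) * conn z m N =
      ∑ i ∈ Finset.range (m + 1),
        if i ≤ m then (starSum w i : 𝕜) * (conn z m N / m) else 0 := by
    simp only [starSum]
    push_cast
    rw [div_mul_eq_mul_div, mul_div_assoc, Finset.sum_mul]
    refine Finset.sum_congr rfl fun i hi => ?_
    rw [if_pos (by simpa [Nat.lt_succ_iff] using hi)]
  rw [e]
  refine hasSum_sum_of_ne_finset_zero fun i hi => if_neg ?_
  simpa [Nat.lt_succ_iff] using hi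

lemma Dominated.hasSum_starSum_mul_connTail (h : Dominated z x K) (N i : ℕ) (w : List Bool) :
    HasSum (fun m : ℕ => if i ≤ m then (starSum w i : 𝕜) * (conn z m N / m) else 0)
      ((starSum w i : 𝕜) * connTail z i N) := by
  rcases eq_or_ne i 0 with rfl | hi
  · simp [starSum_zero]
  · simpa only [mul_ite, mul_zero] using (h.hasSum_connTail hi N).mul_left (starSum w i : 𝕜)

lemma Dominated.summable_starSum_mul_connTail_real (h : Dominated z x K) {w : List Bool} {N : ℕ}
    (hs : Summable fun m => starSum w m * conn x m N) :
    Summable fun m => starSum w m * connTail x m N := by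
  refine Summable.of_nonneg_of_le (fun m => ?_) (fun m => ?_)
    (hs.mul_left (((N : ℝ) + 2) / (1 + x)))
  · refine mul_nonneg (starSum_nonneg w m) (tsum_nonneg fun j => ?_)
    have := conn_nonneg h.lt_zero j N
    split_ifs <;> positivity
  · rcases eq_or_ne m 0 with rfl | hm
    · simp [starSum_zero]
    · rw [mul_left_comm]
      exact mul_le_mul_of_nonneg_left (h.hasSum_connTail_real_le hm N).2 (starSum_nonneg w m)

lemma Dominated.norm_term_le (h : Dominated z x K) (w : List Bool) (N i m : ℕ) :
    ‖if i ≤ m then (starSum w i : 𝕜) * (conn z m N / m) else 0‖ ≤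
      K * if i ≤ m then starSum w i * (conn x m N / m) else 0 := by
  split_ifs
  · rw [norm_mul, norm_div, RCLike.norm_natCast, RCLike.norm_ofReal,
      abs_of_nonneg (starSum_nonneg w i), mul_left_comm, ← mul_div_assoc K]
    have := h.norm_conn_le m N
    have := starSum_nonneg w i
    gcongr
  · simp

lemma Dominated.summable_starSum_mul_conn_real (h : Dominated z x K) (w : List Bool) (N : ℕ) :
    Summable fun m => starSum w m * conn x m N := by
  induction w with
  | nil =>
    refine summable_of_ne_finset_zero (s := {1}) fun m hm => ?_
    simp [starSum, Finset.mem_singleton.not.1 hm]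
  | cons b w ih =>
    cases b
    · refine Summable.of_nonneg_of_le (fun m => mul_nonneg (starSum_nonneg _ m)
        (conn_nonneg h.lt_zero m N)) (fun m => ?_) ih
      refine mul_le_mul_of_nonneg_right ?_ (conn_nonneg h.lt_zero m N)
      rcases eq_or_ne m 0 with rfl | hm
      · simp [starSum_zero]
      · exact div_le_self (starSum_nonneg w m) (by exact_mod_cast Nat.one_le_iff_ne_zero.2 hm)
    · refine (hasSum_swap (𝕜 := ℝ) (fun i m => ?_)
        (fun i => h.real.hasSum_starSum_mul_connTail N i w)
        (h.summable_starSum_mul_connTail_real ih)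
        (fun i => h.real.hasSum_starSum_mul_connTail N i w)
        fun m => hasSum_starSum_mul_connTail_left x N m w).2
      simpa using h.real.norm_term_le w N i m

/-- The summand of the recursion defining `fracSum`, expanded through the connector. -/
lemma Dominated.hasSum_cons (h : Dominated z x K) {w : List Bool}
    (hw : ∀ N, HasSum (fun m => (starSum w m : 𝕜) * conn z m N) (fracSum z w N))
    (b : Bool) (N : ℕ) :
    HasSum (fun m => (starSum (b :: w) m : 𝕜) * conn z m N) (fracSum z (b :: w) N) ∧
    Summable fun n => if N + 1 ≤ n then fracFactor z b n * fracSum z w (nextBound b n) else 0 := by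
  cases b
  · refine hasSum_swap
      (f := fun m n : ℕ => (starSum w m : 𝕜) * if N + 1 ≤ n then conn z m n / n else 0)
      (b := fun m n : ℕ => K * (starSum w m * if N + 1 ≤ n then conn x m n / n else 0))
      (β := fun m => K * (starSum (false :: w) m * conn x m N)) (fun m n => ?_) (fun m => ?_)
      ((h.summable_starSum_mul_conn_real _ N).mul_left K) (fun m => ?_) (fun n => ?_)
    · rw [norm_mul, RCLike.norm_ofReal, abs_of_nonneg (starSum_nonneg w m), mul_left_comm]
      refine mul_le_mul_of_nonneg_left ?_ (starSum_nonneg w m)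
      split_ifs
      · rw [norm_div, RCLike.norm_natCast, ← mul_div_assoc]
        have := h.norm_conn_le m n
        gcongr
      · simp
    · rcases eq_or_ne m 0 with rfl | hm
      · simp [starSum_zero]
      · simp only [starSum]
        rw [div_mul_eq_mul_div, mul_div_assoc]
        exact ((h.real.hasSum_conn_div hm N).mul_left _).mul_left _
    · rcases eq_or_ne m 0 with rfl | hm
      · simp [starSum_zero]
      · simp only [starSum]
        push_cast
        rw [div_mul_eq_mul_div, mul_div_assoc]
        exact (h.hasSum_conn_div hm N).mul_left _
    · split_ifs
      · have := (hw n).mul_left (1 / (n : 𝕜))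
        simp only [fracFactor, nextBound, Bool.false_eq_true, if_false]
        refine hasSum_of_forall_eq this fun m => ?_
        ring
      · simp
  · have hx := h.real.hasSum_starSum_mul_connTail N (w := w)
    have hT : HasSum (fun m => (starSum w m : 𝕜) * connTail z m N) (fracSum z (true :: w) N) ∧
        Summable fun n => if N + 1 ≤ n then
          fracFactor z true n * fracSum z w (nextBound true n) else 0 := by
      refine hasSum_swap
        (f := fun m n : ℕ => (starSum w m : 𝕜) *
          if N + 1 ≤ n then conn z m (n - 1) / ((n : 𝕜) + z) else 0)
        (b := fun m n : ℕ => K * (starSum w m *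
          if N + 1 ≤ n then conn x m (n - 1) / ((n : ℝ) + x) else 0))
        (β := fun m => K * (starSum w m * connTail x m N)) (fun m n => ?_) (fun m => ?_)
        ((h.summable_starSum_mul_connTail_real
          (h.summable_starSum_mul_conn_real w N)).mul_left K) (fun m => ?_) (fun n => ?_)
      · rw [norm_mul, RCLike.norm_ofReal, abs_of_nonneg (starSum_nonneg w m), mul_left_comm]
        refine mul_le_mul_of_nonneg_left ?_ (starSum_nonneg w m)
        split_ifs with hn
        · obtain ⟨n, rfl⟩ : ∃ n', n = n' + 1 := ⟨n - 1, by omega⟩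
          simpa using h.norm_conn_div_le m n
        · simp
      · rcases eq_or_ne m 0 with rfl | hm
        · simp [starSum_zero]
        · exact ((h.real.hasSum_conn_div_add hm N).mul_left _).mul_left _
      · rcases eq_or_ne m 0 with rfl | hm
        · simp [starSum_zero]
        · exact (h.hasSum_conn_div_add hm N).mul_left _
      · split_ifs
        · have := (hw (n - 1)).mul_left (1 / ((n : 𝕜) + z))
          simp only [fracFactor, nextBound, if_true]
          refine hasSum_of_forall_eq this fun m => ?_
          ring
        · simp
    refine ⟨?_, hT.2⟩
    have hK := (h.summable_starSum_mul_connTail_real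
      (h.summable_starSum_mul_conn_real w N)).mul_left K
    obtain ⟨h1, h2⟩ := hasSum_swap (h.norm_term_le w N) (fun i => (hx i).mul_left K) hK
      (fun i => h.hasSum_starSum_mul_connTail N i w)
      fun m => hasSum_starSum_mul_connTail_left z N m w
    rw [hT.1.unique h1]
    exact h2.hasSum

/-- The connected sum identity relating star sums and fraction series. -/
theorem Dominated.hasSum_starSum_mul_conn (h : Dominated z x K) (w : List Bool) (N : ℕ) :
    HasSum (fun m => (starSum w m : 𝕜) * conn z m N) (fracSum z w N) := by
  induction w generalizing N with
  | nil =>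
    have e : fracSum z [] N = (starSum [] 1 : 𝕜) * conn z 1 N := by
      simp [fracSum, starSum, conn]
    rw [e]
    refine hasSum_single 1 fun m hm => ?_
    simp [starSum, hm]
  | cons b w ih => exact (h.hasSum_cons ih b N).1

lemma Dominated.summable_fracSum (h : Dominated z x K) (b : Bool) (w : List Bool) (N : ℕ) :
    Summable fun n => if N + 1 ≤ n then fracFactor z b n * fracSum z w (nextBound b n) else 0 :=
  (h.hasSum_cons (h.hasSum_starSum_mul_conn w) b N).2

/-- The summand of the fraction series of a word, as a function of the whole tuple. -/
noncomputable def fracTerm (z : 𝕜) : (w : List Bool) → ℕ → (Fin w.length → ℕ) → 𝕜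
  | [], N, _ => -z / ((N : 𝕜) + 1)
  | b :: w, N, n =>
    let n' : Fin (w.length + 1) → ℕ := n
    if N + 1 ≤ n' 0 then
      fracFactor z b (n' 0) * fracTerm z w (nextBound b (n' 0)) (fun i => n' i.succ)
    else 0

lemma fracTerm_cons (z : 𝕜) (b : Bool) (w : List Bool) (N a : ℕ) (n : Fin w.length → ℕ) :
    fracTerm z (b :: w) N (Fin.cons a n : Fin (w.length + 1) → ℕ) =
      if N + 1 ≤ a then fracFactor z b a * fracTerm z w (nextBound b a) n else 0 := by
  simp [fracTerm]

lemma Dominated.norm_fracFactor_le (h : Dominated z x K) (b : Bool) {n : ℕ} (hn : 1 ≤ n) :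
    ‖fracFactor z b n‖ ≤ fracFactor x b n := by
  cases b
  · simp [fracFactor]
  · obtain ⟨n, rfl⟩ : ∃ n', n = n' + 1 := ⟨n - 1, by omega⟩
    have := h.le_norm_succ n
    have := h.add_pos n
    simp only [fracFactor, if_true, norm_div, norm_one]
    push_cast
    gcongr

lemma Dominated.norm_fracTerm_le (h : Dominated z x K) (w : List Bool) (N : ℕ)
    (n : Fin w.length → ℕ) : ‖fracTerm z w N n‖ ≤ ‖z‖ / (-x) * fracTerm x w N n := by
  have hx := h.lt_zero
  induction w generalizing N with
  | nil =>
    simp only [fracTerm]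
    rw [norm_div, norm_neg, ← Nat.cast_add_one, RCLike.norm_natCast, ← Nat.cast_add_one,
      ← mul_div_assoc, div_mul_cancel₀ _ (by linarith)]
  | cons b w ih =>
    simp only [fracTerm]
    split_ifs with hN
    · have h1 := h.norm_fracFactor_le b (show 1 ≤ n (0 : Fin (w.length + 1)) by omega)
      rw [norm_mul, mul_left_comm]
      exact mul_le_mul h1 (ih _ _) (norm_nonneg _) ((norm_nonneg _).trans h1)
    · simp

lemma hasSum_fracTerm_cons {z : 𝕜} {b : Bool} {w : List Bool}
    (hw : ∀ N, HasSum (fracTerm z w N) (fracSum z w N)) (N a : ℕ) :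
    HasSum (fun n : Fin w.length → ℕ =>
      fracTerm z (b :: w) N (Fin.cons a n : Fin (w.length + 1) → ℕ))
      (if N + 1 ≤ a then fracFactor z b a * fracSum z w (nextBound b a) else 0) := by
  simp only [fracTerm_cons]
  split_ifs
  · exact (hw _).mul_left _
  · exact hasSum_zero

lemma Dominated.hasSum_fracTerm_of_bound (h : Dominated z x K) {b : Bool} {w : List Bool} {N : ℕ}
    (hz : ∀ N, HasSum (fracTerm z w N) (fracSum z w N))
    (hx : ∀ N, HasSum (fracTerm x w N) (fracSum x w N)) :
    HasSum (fracTerm z (b :: w) N) (fracSum z (b :: w) N) := by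
  have hs := summable_uncurry_of_bound
    (f := fun a n => fracTerm z (b :: w) N (Fin.cons a n : Fin (w.length + 1) → ℕ))
    (fun a n => h.norm_fracTerm_le (b :: w) N (Fin.cons a n : Fin (w.length + 1) → ℕ))
    (fun a => (hasSum_fracTerm_cons hx N a).mul_left _)
    ((h.real.summable_fracSum b w N).mul_left _)
  refine (Fin.consEquiv (n := w.length) fun _ => ℕ).hasSum_iff.1 ?_
  have h1 := hs.hasSum.prod_fiberwise (hasSum_fracTerm_cons hz N)
  rw [fracSum, h1.tsum_eq]
  exact hs.hasSum

lemma hasSum_fracTerm_nil (z : 𝕜) (N : ℕ) : HasSum (fracTerm z [] N) (fracSum z [] N) :=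
  haveI : Unique (Fin ([] : List Bool).length → ℕ) := inferInstanceAs (Unique (Fin 0 → ℕ))
  hasSum_unique (fracTerm z [] N)

theorem Dominated.hasSum_fracTerm (h : Dominated z x K) (w : List Bool) (N : ℕ) :
    HasSum (fracTerm z w N) (fracSum z w N) := by
  have real : ∀ (w : List Bool) (N : ℕ), HasSum (fracTerm x w N) (fracSum x w N) := by
    intro w
    induction w with
    | nil => exact hasSum_fracTerm_nil x
    | cons b w ih => exact fun N => h.real.hasSum_fracTerm_of_bound ih ih
  induction w generalizing N with
  | nil => exact hasSum_fracTerm_nil z N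
  | cons b w ih => exact h.hasSum_fracTerm_of_bound ih (real w)

end Words

lemma exists_prod_range_le {a b : ℕ → ℝ} (ha : ∀ i, 0 ≤ a i) (hb : ∀ i, 0 < b i)
    (h : ∀ᶠ i in atTop, a i ≤ b i) :
    ∃ K, ∀ m, ∏ i ∈ Finset.range m, a i ≤ K * ∏ i ∈ Finset.range m, b i := by
  obtain ⟨k, hk⟩ := eventually_atTop.1 h
  have hbp : ∀ m, 0 < ∏ i ∈ Finset.range m, b i := fun m => Finset.prod_pos fun i _ => hb i
  have hr : ∀ m, 0 ≤ (∏ i ∈ Finset.range m, a i) / ∏ i ∈ Finset.range m, b i := fun m =>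
    div_nonneg (Finset.prod_nonneg fun i _ => ha i) (hbp m).le
  set K := ∑ j ∈ Finset.range (k + 1),
    (∏ i ∈ Finset.range j, a i) / ∏ i ∈ Finset.range j, b i with hK
  have hle : ∀ j ≤ k, ∏ i ∈ Finset.range j, a i ≤ K * ∏ i ∈ Finset.range j, b i := fun j hj => by
    rw [← div_le_iff₀ (hbp j)]
    exact Finset.single_le_sum (f := fun j => (∏ i ∈ Finset.range j, a i) /
      ∏ i ∈ Finset.range j, b i) (fun j _ => hr j) (by simpa [Nat.lt_succ_iff] using hj)
  refine ⟨K, fun m => ?_⟩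
  rcases le_total m k with hm | hm
  · exact hle m hm
  · induction m, hm using Nat.le_induction with
    | base => exact hle k le_rfl
    | succ m hm ih =>
      rw [Finset.prod_range_succ, Finset.prod_range_succ, ← mul_assoc]
      exact mul_le_mul ih (hk m hm) (ha m)
        ((Finset.prod_nonneg fun i _ => ha i).trans ih)

lemma exists_dominated {z : ℂ} (hz : -1 < z.re) : ∃ x K, Dominated z x K := by
  obtain ⟨x, hx1, hx2⟩ := exists_between (lt_min hz (by norm_num : (-1 : ℝ) < 0))
  have hxz : x < z.re := hx2.trans_le (min_le_left _ _)
  have hx0 : x < 0 := hx2.trans_le (min_le_right _ _)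
  have hpos : ∀ i : ℕ, 0 < (i : ℝ) - x := fun i => by
    have := Nat.cast_nonneg (α := ℝ) i
    linarith
  obtain ⟨K, hK⟩ := exists_prod_range_le (a := fun i => ‖(i : ℂ) - z‖) (b := fun i => (i : ℝ) - x)
    (fun i => norm_nonneg _) hpos (by
      have ht : Tendsto (fun i : ℕ => (z.re - x) * (2 * (i : ℝ) - z.re - x)) atTop atTop := by
        refine Tendsto.const_mul_atTop (by linarith) ?_
        refine tendsto_atTop_add_const_right _ _ (tendsto_atTop_add_const_right _ _ ?_)
        exact tendsto_natCast_atTop_atTop.const_mul_atTop two_pos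
      filter_upwards [ht.eventually_ge_atTop (z.im ^ 2)] with i hi
      refine (sq_le_sq₀ (norm_nonneg _) (hpos i).le).1 ?_
      rw [← Complex.normSq_eq_norm_sq, Complex.normSq_apply]
      simp only [Complex.sub_re, Complex.sub_im, Complex.natCast_re, Complex.natCast_im]
      nlinarith)
  exact ⟨x, K, hx1, hx0, hxz.le, fun m => by rw [norm_prod]; exact hK m⟩

/-- The word of an index: each entry `a` contributes `a - 1` letters `false` followed by the
letter `true`. -/
def indexWord : List ℕ → List Bool
  | [] => []
  | a :: t => List.replicate (a - 1) false ++ true :: indexWord t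

lemma starSum_replicate_append (j : ℕ) (w : List Bool) (m : ℕ) :
    starSum (List.replicate j false ++ w) m = starSum w m / (m : ℝ) ^ j := by
  induction j with
  | zero => simp
  | succ j ih =>
    rw [List.replicate_succ, List.cons_append, starSum, ih, div_div, pow_succ]

lemma starSum_indexWord_cons {a : ℕ} (ha : 0 < a) (t : List ℕ) (m : ℕ) :
    starSum (indexWord (a :: t)) m =
      (∑ i ∈ Finset.range (m + 1), starSum (indexWord t) i) / (m : ℝ) ^ a := by
  rw [indexWord, starSum_replicate_append, starSum, div_div, ← pow_succ', Nat.sub_add_cancel ha]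

/-- The star sum `sStar` with exponents given by a function, over tuples bounded by `B`. -/
noncomputable def boundedStar (e : ℕ → ℕ) (r B N : ℕ) : ℝ :=
  ∑ m : Fin r → Fin (B + 1),
    if (∀ i, 0 < (m i : ℕ)) ∧ (∀ i j : Fin r, i ≤ j → (m i : ℕ) ≤ (m j : ℕ)) ∧
       (∀ i : Fin r, (i : ℕ) + 1 = r → (m i : ℕ) = N)
    then ∏ i : Fin r, 1 / ((m i : ℕ) : ℝ) ^ e i
    else 0

lemma sStar_eq_boundedStar (k : List ℕ) (N : ℕ) :
    sStar k N = boundedStar (fun i => k.getD i 0) k.length N N := by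
  unfold sStar boundedStar
  refine Finset.sum_congr rfl fun m _ => ?_
  simp

lemma boundedStar_congr {e e' : ℕ → ℕ} {r : ℕ} (h : ∀ i < r, e i = e' i) (B N : ℕ) :
    boundedStar e r B N = boundedStar e' r B N := by
  unfold boundedStar
  refine Finset.sum_congr rfl fun m _ => ?_
  simp only [h _ (Fin.is_lt _)]

lemma boundedStar_eq_self (e : ℕ → ℕ) (r : ℕ) {B N : ℕ} (h : N ≤ B) :
    boundedStar e r B N = boundedStar e r N N := by
  symm
  have hN : N + 1 ≤ B + 1 := by omega
  refine Fintype.sum_of_injective (fun (m : Fin r → Fin (N + 1)) i => Fin.castLE hN (m i))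
    (fun m m' hm => funext fun i => Fin.castLE_injective hN (congrFun hm i)) _ _ ?_ ?_
  · intro m hm
    refine if_neg fun ⟨_, h2, h3⟩ => hm ?_
    have hle : ∀ i, (m i : ℕ) < N + 1 := fun i => by
      have hr : r - 1 < r := by have := i.2; omega
      have h3' := h3 ⟨r - 1, hr⟩ (by simp only; omega)
      have := h2 i ⟨r - 1, hr⟩ (by rw [Fin.le_def]; simp only; omega)
      omega
    exact ⟨fun i => ⟨m i, hle i⟩, rfl⟩
  · intro m
    simp

lemma boundedStar_one (e : ℕ → ℕ) {B N : ℕ} (hN : 0 < N) (h : N ≤ B) :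
    boundedStar e 1 B N = 1 / (N : ℝ) ^ e 0 := by
  have hB : N < B + 1 := by omega
  unfold boundedStar
  rw [Fintype.sum_eq_single (fun _ => (⟨N, hB⟩ : Fin (B + 1)))]
  · simp [hN]
  · intro m hm
    refine if_neg fun ⟨_, _, h3⟩ => hm ?_
    funext i
    exact Fin.ext (h3 i (by omega))

lemma boundedStar_succ (e : ℕ → ℕ) (r : ℕ) {B N : ℕ} (hN : 0 < N) (h : N ≤ B) :
    boundedStar e (r + 2) B N =
      (∑ M ∈ Finset.range (N + 1), boundedStar e (r + 1) B M) / (N : ℝ) ^ e (r + 1) := by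
  have hB : N < B + 1 := by omega
  unfold boundedStar
  rw [← (Fin.snocEquiv (n := r + 1) fun _ => Fin (B + 1)).sum_comp, Fintype.sum_prod_type,
    Fintype.sum_eq_single (⟨N, hB⟩ : Fin (B + 1))]
  · rw [Finset.sum_comm, Finset.sum_div]
    refine Finset.sum_congr rfl fun m _ => ?_
    have hlast : ∀ M, (∀ i : Fin (r + 1), (i : ℕ) + 1 = r + 1 → (m i : ℕ) = M) ↔
        (m (Fin.last r) : ℕ) = M := fun M =>
      ⟨fun hi => hi _ (by simp), fun hi i hir => by
        rwa [show i = Fin.last r from Fin.ext (by simpa using hir)]⟩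
    let q : Fin (r + 2) → Fin (B + 1) := Fin.snoc m ⟨N, hB⟩
    have hq : ∀ i, q (Fin.castSucc i) = m i := fun i => Fin.snoc_castSucc ..
    have hq' : q (Fin.last (r + 1)) = ⟨N, hB⟩ := Fin.snoc_last ..
    have hcond : ((∀ i, 0 < (q i : ℕ)) ∧
        (∀ i j : Fin (r + 2), i ≤ j →
          (q i : ℕ) ≤
          (q j : ℕ)) ∧
        (∀ i : Fin (r + 2), (i : ℕ) + 1 = r + 2 →
          (q i : ℕ) = N)) ↔
        ((∀ i, 0 < (m i : ℕ)) ∧ (∀ i j : Fin (r + 1), i ≤ j → (m i : ℕ) ≤ (m j : ℕ))) ∧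
          (m (Fin.last r) : ℕ) ≤ N := by
      constructor
      · rintro ⟨h1, h2, -⟩
        refine ⟨⟨fun i => by simpa [hq] using h1 i.castSucc,
          fun i j hij => by simpa [hq] using h2 i.castSucc j.castSucc (by simpa using hij)⟩, ?_⟩
        simpa [hq, hq'] using h2 (Fin.last r).castSucc (Fin.last (r + 1)) (Fin.le_last _)
      · rintro ⟨⟨h1, h2⟩, h3⟩
        refine ⟨fun i => ?_, fun i j hij => ?_, fun i hi => ?_⟩
        · induction i using Fin.lastCases with
          | last => simpa [hq'] using hN
          | cast i => simpa [hq] using h1 i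
        · induction j using Fin.lastCases with
          | last =>
            induction i using Fin.lastCases with
            | last => exact le_rfl
            | cast i => simpa [hq, hq'] using (h2 i _ (Fin.le_last i)).trans h3
          | cast j =>
            induction i using Fin.lastCases with
            | last => exact absurd hij (by simp)
            | cast i => simpa [hq] using h2 i j (by simpa using hij)
        · rw [show i = Fin.last (r + 1) from Fin.ext (by simpa using hi)]
          simp [hq']
    simp only [Fin.snocEquiv, Equiv.coe_fn_mk, hlast, ← and_assoc]
    simp only [← and_assoc] at hcond
    rw [if_congr hcond rfl rfl]
    by_cases hc : (∀ i, 0 < (m i : ℕ)) ∧ (∀ i j : Fin (r + 1), i ≤ j → (m i : ℕ) ≤ (m j : ℕ))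
    · simp only [and_iff_right hc, Finset.sum_ite_eq, Finset.mem_range, Nat.lt_succ_iff]
      split_ifs
      · rw [Fin.prod_univ_castSucc]
        simp [div_eq_mul_inv]
      · simp
    · simp only [hc, false_and, if_false, Finset.sum_const_zero, zero_div]
  · intro a ha
    refine Finset.sum_eq_zero fun m _ => if_neg fun ⟨_, _, h3⟩ => ha (Fin.ext ?_)
    simpa [Fin.snocEquiv] using h3 (Fin.last (r + 1)) (by simp)

lemma sStar_zero {k : List ℕ} (hk : k ≠ []) : sStar k 0 = 0 := by
  refine Finset.sum_eq_zero fun m _ => if_neg fun ⟨h1, _, _⟩ => ?_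
  have := h1 ⟨0, List.length_pos_iff.2 hk⟩
  omega

lemma sStar_append_singleton_s13 {k : List ℕ} (hk : k ≠ []) (a : ℕ) {N : ℕ} (hN : 0 < N) :
    sStar (k ++ [a]) N = (∑ M ∈ Finset.range (N + 1), sStar k M) / (N : ℝ) ^ a := by
  obtain ⟨r, hr⟩ : ∃ r, k.length = r + 1 :=
    Nat.exists_eq_succ_of_ne_zero (List.length_pos_iff.2 hk).ne'
  rw [sStar_eq_boundedStar, List.length_append, List.length_singleton, hr,
    boundedStar_succ _ _ hN le_rfl]
  congr 1
  · refine Finset.sum_congr rfl fun M hM => ?_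
    rw [sStar_eq_boundedStar, hr, boundedStar_eq_self _ _ (by simpa [Nat.lt_succ_iff] using hM)]
    refine boundedStar_congr (fun i hi => ?_) _ _
    rw [List.getD_append _ _ _ _ (by omega)]
  · rw [List.getD_append_right _ _ _ _ (by omega), hr]
    simp

lemma sStar_eq_starSum {t : List ℕ} (ht : t ≠ []) (hpos : ∀ a ∈ t, 0 < a) (N : ℕ) :
    sStar t.reverse N = starSum (indexWord t) N := by
  induction t generalizing N with
  | nil => exact absurd rfl ht
  | cons a t ih =>
    rcases Nat.eq_zero_or_pos N with rfl | hN
    · rw [sStar_zero (by simp), starSum_zero]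
    rw [starSum_indexWord_cons (hpos a (by simp)), List.reverse_cons]
    rcases eq_or_ne t [] with rfl | ht'
    · have hs : ∑ i ∈ Finset.range (N + 1), starSum (indexWord []) i = 1 := by
        simp only [indexWord, starSum, Finset.sum_ite_eq', Finset.mem_range]
        rw [if_pos (by omega)]
      rw [hs, sStar_eq_boundedStar]
      simpa using boundedStar_one (fun i => [a].getD i 0) hN le_rfl
    · rw [sStar_append_singleton_s13 (by simpa using ht') a hN]
      congr 1
      exact Finset.sum_congr rfl fun M _ => ih ht' (fun b hb => hpos b (by simp [hb])) M

lemma length_indexWord {t : List ℕ} (hpos : ∀ a ∈ t, 0 < a) : (indexWord t).length = t.sum := by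
  induction t with
  | nil => rfl
  | cons a t ih =>
    have := ih fun b hb => hpos b (by simp [hb])
    have := hpos a (by simp)
    simp only [indexWord, List.length_append, List.length_replicate, List.length_cons,
      List.sum_cons]
    omega

lemma getD_indexWord {t : List ℕ} (hpos : ∀ a ∈ t, 0 < a) {i : ℕ} (hi : i < t.sum) :
    (indexWord t).getD i false = true ↔ ∃ j < t.length, (t.take (j + 1)).sum = i + 1 := by
  induction t generalizing i with
  | nil => simp at hi
  | cons a t ih =>
    have ha := hpos a (by simp)
    simp only [List.length_cons, List.take_succ_cons, List.sum_cons] at hi ⊢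
    rw [indexWord]
    rcases lt_trichotomy (i + 1) a with h | h | h
    · rw [List.getD_append _ _ _ _ (by simp; omega), List.getD_replicate _ (by omega)]
      simp only [Bool.false_eq_true, false_iff, not_exists, not_and]
      intro j _
      omega
    · rw [List.getD_append_right _ _ _ _ (by simp; omega)]
      simp only [List.length_replicate, show i - (a - 1) = 0 by omega, List.getD_cons_zero,
        true_iff]
      exact ⟨0, by omega, by simpa using h.symm⟩
    · obtain ⟨i, rfl⟩ : ∃ i', i = a + i' := ⟨i - a, by omega⟩
      rw [List.getD_append_right _ _ _ _ (by simp; omega)]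
      simp only [List.length_replicate, show a + i - (a - 1) = i + 1 by omega,
        List.getD_cons_succ]
      rw [ih (fun b hb => hpos b (by simp [hb])) (by omega)]
      constructor
      · rintro ⟨j, hj, hs⟩
        exact ⟨j + 1, by omega, by omega⟩
      · rintro ⟨j, hj, hs⟩
        rcases j with _ | j
        · simp only [List.take_zero, List.sum_nil] at hs
          omega
        · exact ⟨j, by omega, by omega⟩

lemma mem_Aset_iff {t : List ℕ} (hpos : ∀ a ∈ t, 0 < a) {i : ℕ} (hi : i + 1 < t.sum) :
    i + 1 ∈ Aset t ↔ (indexWord t).getD i false = true := by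
  rw [getD_indexWord hpos (by omega)]
  simp only [Aset, Finset.mem_image, Finset.mem_Ico]
  constructor
  · rintro ⟨j, ⟨h1, h2⟩, hs⟩
    exact ⟨j - 1, by omega, by rwa [Nat.sub_add_cancel h1]⟩
  · rintro ⟨j, hj, hs⟩
    refine ⟨j + 1, ⟨by omega, lt_of_le_of_ne hj fun h => ?_⟩, hs⟩
    rw [h, List.take_length] at hs
    omega

lemma getLast?_indexWord {t : List ℕ} (ht : t ≠ []) : (indexWord t).getLast? = some true := by
  induction t with
  | nil => exact absurd rfl ht
  | cons a t ih =>
    rw [indexWord, List.getLast?_append_cons]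
    rcases eq_or_ne t [] with rfl | ht'
    · rfl
    · rw [List.getLast?_cons, ih ht']
      rfl

/-- The order conditions between neighbouring entries prescribed by a word. -/
def ChainCond (w : List Bool) {L : ℕ} (n : Fin L → ℕ) : Prop :=
  ∀ (i : Fin L) (h : (i : ℕ) + 1 < L),
    if w.getD i false = true then n i ≤ n ⟨i + 1, h⟩ else n i < n ⟨i + 1, h⟩

lemma ChainCond.pos {w : List Bool} {L : ℕ} {n : Fin L → ℕ} (h : ChainCond w n)
    (h0 : ∀ hL : 0 < L, 0 < n ⟨0, hL⟩) (j : Fin L) : 0 < n j := by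
  obtain ⟨j, hj⟩ := j
  induction j with
  | zero => exact h0 hj
  | succ j ih =>
    have h1 := ih (by omega)
    have h2 := h ⟨j, by omega⟩ hj
    dsimp only at h2
    split_ifs at h2 <;> omega

lemma chainCond_cons (b : Bool) (w : List Bool) {L : ℕ} (n : Fin (L + 2) → ℕ) :
    ChainCond (b :: w) n ↔
      (if b = true then n 0 ≤ n 1 else n 0 < n 1) ∧ ChainCond w (fun i => n i.succ) := by
  constructor
  · intro h
    refine ⟨by simpa using h 0 (by simp), fun i hi => ?_⟩
    simpa using h i.succ (by simpa using hi)
  · rintro ⟨h0, h1⟩ i hi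
    induction i using Fin.cases with
    | zero => simpa using h0
    | succ i => exact h1 i (by simpa using hi)

open Classical in
lemma ite_chainCond_eq_neg_fracTerm {z : ℂ} (hz : ∀ n : ℕ, (n : ℂ) + 1 + z ≠ 0) {w : List Bool}
    (hw : w.getLast? = some true) (N : ℕ) (n : Fin w.length → ℕ) :
    (if (∀ h : 0 < w.length, N < n ⟨0, h⟩) ∧ ChainCond w n then
      ∏ j : Fin w.length, if (j : ℕ) + 1 = w.length then 1 / (n j : ℂ) - 1 / ((n j : ℂ) + z)
        else fracFactor z (w.getD j false) (n j)
      else 0) = -fracTerm z w N n := by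
  induction w generalizing N with
  | nil => simp at hw
  | cons b w ih =>
    rcases w with _ | ⟨b', w⟩
    · obtain rfl : b = true := by simpa using hw
      have hc : ChainCond [true] n := fun i hi => by simp at hi
      simp only [List.length_cons, List.length_nil, fracTerm, fracFactor, nextBound] at n hc ⊢
      by_cases hN : N + 1 ≤ n 0
      · obtain ⟨k, hk⟩ : ∃ k, n 0 = k + 1 := ⟨n 0 - 1, by omega⟩
        have hk1 : (k : ℂ) + 1 ≠ 0 := Nat.cast_add_one_ne_zero k
        have hk2 := hz k
        rw [if_pos ⟨fun _ => hN, hc⟩, if_pos hN]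
        simp [hk]
        field_simp
        ring
      · rw [if_neg fun h => hN (h.1 (by simp)), if_neg hN, neg_zero]
    · have ih' := fun N => ih (by simpa [List.getLast?_cons_cons] using hw) N
        (fun i => n (Fin.succ i))
      rw [fracTerm]
      change Fin (w.length + 2) → ℕ at n
      by_cases hN : N + 1 ≤ n 0
      · rw [if_pos hN, ← mul_neg, ← ih', mul_ite, mul_zero]
        refine if_congr ?_ ?_ rfl
        · have hcc := chainCond_cons b (b' :: w) n
          refine Iff.trans (and_congr_right fun _ => hcc) ?_
          refine Iff.trans ⟨fun h => h.2, fun h => ⟨fun _ => hN, h⟩⟩ (and_congr_left fun _ => ?_)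
          refine Iff.trans ?_ (forall_prop_of_true (by simp)).symm
          change _ ↔ nextBound b (n 0) < n 1
          cases b <;> simp [nextBound]
          omega
        · change ∏ j : Fin (w.length + 1 + 1), _ = _
          rw [Fin.prod_univ_succ]
          congr 1
          simp
      · rw [if_neg fun h => hN (h.1 (by simp)), if_neg hN, neg_zero]

lemma G_eq_tsum {z : ℂ} (hz : ∀ n : ℕ, (n : ℂ) + 1 + z ≠ 0) {t : List ℕ} (ht : t ≠ [])
    (hpos : ∀ a ∈ t, 0 < a) :
    G t z = ∑' n : Fin (indexWord t).length → ℕ, -fracTerm z (indexWord t) 0 n := by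
  have key : ∀ (L : ℕ) (A : Finset ℕ), L = (indexWord t).length →
      (∀ i, i + 1 < L → (i + 1 ∈ A ↔ (indexWord t).getD i false = true)) →
      (∑' n : Fin L → ℕ, open Classical in
        if (∀ j, 0 < n j) ∧
          (∀ (i : Fin L) (h : (i : ℕ) + 1 < L),
            if (i : ℕ) + 1 ∈ A then n i ≤ n ⟨(i : ℕ) + 1, h⟩
            else n i < n ⟨(i : ℕ) + 1, h⟩)
        then ∏ j : Fin L,
          if (j : ℕ) + 1 = L then 1 / ((n j : ℕ) : ℂ) - 1 / (((n j : ℕ) : ℂ) + z)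
          else if (j : ℕ) + 1 ∈ A then 1 / (((n j : ℕ) : ℂ) + z)
          else 1 / ((n j : ℕ) : ℂ)
        else 0) = ∑' n : Fin (indexWord t).length → ℕ, -fracTerm z (indexWord t) 0 n := by
    classical
    rintro L A rfl hA
    refine tsum_congr fun n => ?_
    rw [← ite_chainCond_eq_neg_fracTerm hz (getLast?_indexWord ht)]
    have hc : (∀ (i : Fin (indexWord t).length) (h : (i : ℕ) + 1 < (indexWord t).length),
        if (i : ℕ) + 1 ∈ A then n i ≤ n ⟨(i : ℕ) + 1, h⟩
        else n i < n ⟨(i : ℕ) + 1, h⟩) ↔ ChainCond (indexWord t) n :=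
      forall_congr' fun i => forall_congr' fun h => by simp only [hA i h]
    refine if_congr ⟨fun h => ⟨fun _ => h.1 _, hc.1 h.2⟩, fun h => ⟨h.2.pos h.1, hc.2 h.2⟩⟩
      (Finset.prod_congr rfl fun j _ => ?_) rfl
    by_cases hj : (j : ℕ) + 1 = (indexWord t).length
    · simp only [hj, if_true]
    · simp only [hj, if_false, fracFactor, hA j (by omega)]
  exact key _ _ (length_indexWord hpos).symm fun i hi => mem_Aset_iff hpos hi

lemma pos_of_mem_zipWith_sub {l : List ℕ} {c : ℕ} (h : (c :: l).Pairwise (· < ·)) :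
    ∀ a ∈ List.zipWith (fun a b => a - b) l (c :: l), 0 < a := by
  induction l generalizing c with
  | nil => simp
  | cons d l ih =>
    intro a ha
    rw [List.zipWith_cons_cons, List.mem_cons] at ha
    obtain ⟨hc, hl⟩ := List.pairwise_cons.1 h
    rcases ha with rfl | ha
    · exact Nat.sub_pos_of_lt (hc d (by simp))
    · exact ih hl a ha

lemma hdual_pos {k : List ℕ} (hk : 0 < k.sum) : ∀ a ∈ hdual k, 0 < a := by
  refine pos_of_mem_zipWith_sub (List.pairwise_cons.2 ⟨fun a ha => ?_, ?_⟩)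
  · rw [Finset.mem_sort, Finset.mem_insert, Finset.mem_sdiff, Finset.mem_Icc] at ha
    omega
  · exact Finset.sortedLT_sort _ |>.pairwise

lemma hdual_ne_nil (k : List ℕ) : hdual k ≠ [] := by
  rw [← List.length_pos_iff]
  simp [hdual]

lemma cbinom_eq (z : ℂ) (n : ℕ) : cbinom z n = (-1) ^ n * conn z n 0 := by
  have h1 : (n.factorial : ℂ) = ∏ i ∈ Finset.range n, ((i : ℂ) + 1) := by
    rw [← Finset.prod_range_add_one_eq_factorial]
    push_cast
    rfl
  have h2 : (-1 : ℂ) ^ n = ∏ i ∈ Finset.range n, (-1 : ℂ) := by simp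
  rw [cbinom, descPochhammer_eval_eq_prod_range, h1, conn, ← Finset.prod_div_distrib, h2,
    ← Finset.prod_mul_distrib]
  refine Finset.prod_congr rfl fun i _ => ?_
  simp only [Nat.cast_zero, zero_add]
  ring

lemma F_eq_neg_fracSum {z : ℂ} {x K : ℝ} (h : Dominated z x K) {k : List ℕ} (hk : k ≠ [])
    {w : List Bool} (hw : ∀ N, sStar (hdual k) N = starSum w N) :
    F k z = -fracSum z w 0 := by
  have hs := ((hasSum_nat_add_iff' 1).2 (h.hasSum_starSum_mul_conn w 0)).neg
  rw [Finset.sum_range_one, starSum_zero] at hs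
  rw [F, if_neg hk, ← sub_zero (fracSum z w 0)]
  refine HasSum.tsum_eq (hasSum_of_forall_eq (by simpa using hs) fun n => ?_)
  rw [cbinom_eq, hw, pow_succ]
  linear_combination ((starSum w (n + 1) : ℂ) * conn z (n + 1) 0) *
    (by rw [← mul_pow]; norm_num : (-1 : ℂ) ^ n * (-1) ^ n = 1)

/-- Kawashima's fraction series (second form):
`F_k(z) = G_{rev(k∨)}(z)` for `Re(z) > -1`. -/
theorem F_eq_G (k : List ℕ) (hk : k ≠ []) (hpos : ∀ x ∈ k, 0 < x)
    (z : ℂ) (hz : -1 < z.re) :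
    F k z = G ((hdual k).reverse) z := by
  obtain ⟨x, K, h⟩ := exists_dominated hz
  have hsum : 0 < k.sum := List.sum_pos k hpos hk
  have ht : (hdual k).reverse ≠ [] := by simpa using hdual_ne_nil k
  have htpos : ∀ a ∈ (hdual k).reverse, 0 < a := fun a ha =>
    hdual_pos hsum a (List.mem_reverse.1 ha)
  rw [G_eq_tsum h.add_ne_zero ht htpos, (h.hasSum_fracTerm _ 0).neg.tsum_eq]
  exact F_eq_neg_fracSum h hk fun N => by
    rw [← sStar_eq_starSum ht htpos, List.reverse_reverse]

end Kawashima
end
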